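/- arXiv:1306.4412 — 2 statements merged into one kernel-verified Lean document; each statement's English description precedes it below -/
import Mathlib

section
/- Assume ν > −1/2. Fix ρ ∈ C^∞[0,∞) with ρ = 1 on (0, 5101/10000] and ρ = 0 outside (0, 2/3), so that supp ρ″ ⊂ (1/2, 2/3). Then there is a constant C (depending on ν and on ‖ρ′‖_∞, ‖ρ″‖_∞) such that for all x, y ∈ (0, 5101/10000] and 0 < t < 1, ∫_0^t ∫_0^∞ 𝐓_{t−s}(x,z) |ρ″(z)| 𝒯_s(z,y) z^{2ν+1} dz ds ≤ C. -/
open MeasureTheory Real Set Filter Topology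
open scoped ENNReal NNReal

/-- Bessel function of the first kind of order `ν` (defined by its power series). -/
noncomputable def besselJ (ν x : ℝ) : ℝ :=
  ∑' m : ℕ, ((-1 : ℝ) ^ m / ((m.factorial : ℝ) * Real.Gamma ((m : ℝ) + ν + 1))) *
    (x / 2) ^ (2 * (m : ℝ) + ν)

/-- `Λ` enumerates the successive positive zeros of `J_ν`, in increasing order,
`Λ n` corresponding to `λ_{n+1,ν}`. -/
def IsPositiveZerosOfBesselJ (ν : ℝ) (Λ : ℕ → ℝ) : Prop :=
  StrictMono Λ ∧ (∀ n, 0 < Λ n) ∧ (∀ n, besselJ ν (Λ n) = 0) ∧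
    ∀ x : ℝ, 0 < x → besselJ ν x = 0 → ∃ n, Λ n = x

/-- The eigenfunctions `φ_n^ν`. -/
noncomputable def phiFB (ν : ℝ) (Λ : ℕ → ℝ) (n : ℕ) (x : ℝ) : ℝ :=
  (Real.sqrt 2 / |Λ n * besselJ (ν + 1) (Λ n)|) * Real.sqrt (Λ n) *
    besselJ ν (Λ n * x) * x ^ (-ν)

/-- The Fourier–Bessel Poisson kernel `𝒫_t(x,y)`. -/
noncomputable def pKer (ν : ℝ) (Λ : ℕ → ℝ) (t x y : ℝ) : ℝ :=
  ∑' n : ℕ, Real.exp (-t * Λ n) * phiFB ν Λ n x * phiFB ν Λ n y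

/-- The kernel `P_t(x,y) = (xy)^{ν+1/2} 𝒫_t(x,y)`. -/
noncomputable def pKerL (ν : ℝ) (Λ : ℕ → ℝ) (t x y : ℝ) : ℝ :=
  (x * y) ^ (ν + 1/2) * pKer ν Λ t x y

/-- The measure `dμ(x) = x^{2ν+1} dx` on `(0,1)`. -/
noncomputable def muMeas (ν : ℝ) : Measure ℝ :=
  (volume.restrict (Ioo 0 1)).withDensity fun x => ENNReal.ofReal (x ^ (2 * ν + 1))

noncomputable def pI (j : ℕ) : ℝ := 1 - (1/2 : ℝ) ^ j
noncomputable def qI (j : ℕ) : ℝ := 1 - (1/2 : ℝ) ^ (j + 1)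

/-- The `s`-dilate (same center, `s` times the length) of `(p,q]`, intersected with `(0,1)`. -/
def starSet (s p q : ℝ) : Set ℝ :=
  Ioc ((p + q)/2 - s * (q - p)/2) ((p + q)/2 + s * (q - p)/2) ∩ Ioo 0 1

noncomputable def Istar (j : ℕ) : Set ℝ := starSet (51/50) (pI j) (qI j)
noncomputable def Istar2 (j : ℕ) : Set ℝ := starSet ((51/50)^2) (pI j) (qI j)

noncomputable def pJ (j : ℤ) : ℝ := if 1 ≤ j then 1 - (2:ℝ) ^ (-j) else (2:ℝ) ^ (j - 1)
noncomputable def qJ (j : ℤ) : ℝ := if 1 ≤ j then 1 - (2:ℝ) ^ (-j - 1) else (2:ℝ) ^ j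

noncomputable def Jstar (j : ℤ) : Set ℝ := starSet (51/50) (pJ j) (qJ j)
noncomputable def Jstar2 (j : ℤ) : Set ℝ := starSet ((51/50)^2) (pJ j) (qJ j)

/-- Modified Bessel function of the first kind. -/
noncomputable def besselI (ν x : ℝ) : ℝ :=
  ∑' m : ℕ, (1 / ((m.factorial : ℝ) * Real.Gamma ((m : ℝ) + ν + 1))) *
    (x / 2) ^ (2 * (m : ℝ) + ν)

/-- The Bessel heat kernel `𝐓_t(x,y)` on `(0,∞)`. -/
noncomputable def bHeatKer (ν t x y : ℝ) : ℝ :=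
  (2*t)⁻¹ * Real.exp (-(x^2 + y^2)/(4*t)) * besselI ν (x*y/(2*t)) * (x*y) ^ (-ν)

/-- The Fourier–Bessel heat kernel `𝒯_t(x,y)` on `(0,1)`. -/
noncomputable def fbHeatKer (ν : ℝ) (Λ : ℕ → ℝ) (t x y : ℝ) : ℝ :=
  ∑' n : ℕ, Real.exp (-t * (Λ n)^2) * phiFB ν Λ n x * phiFB ν Λ n y

/-- The entire function `∑ w ^ m / (m! Γ(m + ν + 1))`, through which both `J_ν` and `I_ν` are
expressed. -/
noncomputable def besselSeries (ν w : ℝ) : ℝ :=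
  ∑' m : ℕ, w ^ m / ((m.factorial : ℝ) * Real.Gamma ((m : ℝ) + ν + 1))

theorem pow_mul_Gamma_le {s : ℝ} (hs : 0 < s) (m : ℕ) :
    s ^ m * Real.Gamma s ≤ Real.Gamma ((m : ℝ) + s) := by
  induction m with
  | zero => simp
  | succ m ih =>
    have h1 : (0 : ℝ) < (m : ℝ) + s := by positivity
    have h2 : ((m + 1 : ℕ) : ℝ) + s = (m + s) + 1 := by push_cast; ring
    rw [h2, Real.Gamma_add_one h1.ne', pow_succ', mul_assoc]
    have := Real.Gamma_pos_of_pos hs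
    gcongr
    linarith [(Nat.cast_nonneg m : (0 : ℝ) ≤ m)]

theorem Gamma_natCast_add_pos {ν : ℝ} (hν : -1 < ν) (m : ℕ) :
    0 < Real.Gamma ((m : ℝ) + ν + 1) :=
  Real.Gamma_pos_of_pos (by linarith [(Nat.cast_nonneg m : (0 : ℝ) ≤ m)])

theorem norm_besselSeries_term_le {ν : ℝ} (hν : -1 < ν) {w R : ℝ} (hw : |w| ≤ R) (m : ℕ) :
    ‖w ^ m / ((m.factorial : ℝ) * Real.Gamma ((m : ℝ) + ν + 1))‖ ≤
      (R / (ν + 1)) ^ m / (m.factorial : ℝ) * (Real.Gamma (ν + 1))⁻¹ := by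
  have hs : 0 < ν + 1 := by linarith
  have hG := Real.Gamma_pos_of_pos hs
  have h1 := pow_mul_Gamma_le hs m
  have hm : (0 : ℝ) < m.factorial := by positivity
  rw [← add_assoc] at h1
  rw [norm_div, norm_pow, Real.norm_eq_abs, Real.norm_of_nonneg
    (mul_pos hm (Gamma_natCast_add_pos hν m)).le]
  have hR : 0 ≤ R := (abs_nonneg w).trans hw
  calc |w| ^ m / ((m.factorial : ℝ) * Real.Gamma ((m : ℝ) + ν + 1))
      ≤ R ^ m / ((m.factorial : ℝ) * ((ν + 1) ^ m * Real.Gamma (ν + 1))) := by gcongr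
    _ = _ := by rw [div_pow]; field_simp

theorem summable_besselSeries_bound (ν R : ℝ) :
    Summable fun m : ℕ => (R / (ν + 1)) ^ m / (m.factorial : ℝ) * (Real.Gamma (ν + 1))⁻¹ :=
  (Real.summable_pow_div_factorial _).mul_right _

theorem summable_besselSeries {ν : ℝ} (hν : -1 < ν) (w : ℝ) :
    Summable fun m : ℕ => w ^ m / ((m.factorial : ℝ) * Real.Gamma ((m : ℝ) + ν + 1)) :=
  .of_norm_bounded (summable_besselSeries_bound ν |w|)
    (norm_besselSeries_term_le hν le_rfl)

theorem besselSeries_deriv_term (ν w : ℝ) (m : ℕ) :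
    ((m + 1 : ℕ) : ℝ) * w ^ m /
        (((m + 1).factorial : ℝ) * Real.Gamma (((m + 1 : ℕ) : ℝ) + ν + 1)) =
      w ^ m / ((m.factorial : ℝ) * Real.Gamma ((m : ℝ) + (ν + 1) + 1)) := by
  have h1 : ((m + 1 : ℕ) : ℝ) ≠ 0 := by positivity
  rw [Nat.factorial_succ, Nat.cast_mul, mul_assoc, mul_div_mul_left _ _ h1]
  congr 3
  push_cast
  ring

theorem hasDerivAt_besselSeries {ν : ℝ} (hν : -1 < ν) (w : ℝ) :
    HasDerivAt (besselSeries ν) (besselSeries (ν + 1) w) w := by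
  have hν' : -1 < ν + 1 := by linarith
  have hg (m : ℕ) (y : ℝ) : HasDerivAt (fun z : ℝ => z ^ (m + 1) /
      (((m + 1).factorial : ℝ) * Real.Gamma (((m + 1 : ℕ) : ℝ) + ν + 1)))
      (y ^ m / ((m.factorial : ℝ) * Real.Gamma ((m : ℝ) + (ν + 1) + 1))) y := by
    rw [← besselSeries_deriv_term]
    have h := (hasDerivAt_pow (m + 1) y).div_const
      (((m + 1).factorial : ℝ) * Real.Gamma (((m + 1 : ℕ) : ℝ) + ν + 1))
    rwa [Nat.add_sub_cancel] at h
  have key := hasDerivAt_tsum_of_isPreconnected (t := Metric.ball 0 (|w| + 1)) (y₀ := w) (y := w)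
      (summable_besselSeries_bound (ν + 1) (|w| + 1)) Metric.isOpen_ball
      (convex_ball _ _).isPreconnected (fun m y _ => hg m y)
      (fun m y hy => norm_besselSeries_term_le hν' (by simpa using (Metric.mem_ball.1 hy).le) m)
      (by simp) ((summable_nat_add_iff 1).2 (summable_besselSeries hν w)) (by simp)
  have h2 : besselSeries ν = fun z => 1 / Real.Gamma (ν + 1) + ∑' m : ℕ, z ^ (m + 1) /
      (((m + 1).factorial : ℝ) * Real.Gamma (((m + 1 : ℕ) : ℝ) + ν + 1)) := by
    funext z
    rw [besselSeries, (summable_besselSeries hν z).tsum_eq_zero_add]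
    simp
  rw [h2]
  exact key.const_add _

theorem continuous_besselSeries {ν : ℝ} (hν : -1 < ν) : Continuous (besselSeries ν) :=
  continuous_iff_continuousAt.2 fun w => (hasDerivAt_besselSeries hν w).continuousAt

theorem besselSeries_ode {ν : ℝ} (hν : -1 < ν) (w : ℝ) :
    w * besselSeries (ν + 1 + 1) w + (ν + 1) * besselSeries (ν + 1) w = besselSeries ν w := by
  have hs1 := summable_besselSeries (ν := ν + 1) (by linarith) w
  have hs2 := summable_besselSeries (ν := ν + 1 + 1) (by linarith) w
  have e0 := (summable_besselSeries hν w).tsum_eq_zero_add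
  have e1 := hs1.tsum_eq_zero_add
  have t1 := (summable_nat_add_iff 1).2 hs1
  rw [besselSeries, besselSeries, besselSeries, e0, e1, ← tsum_mul_left, mul_add, ← tsum_mul_left,
    add_left_comm, ← (hs2.mul_left w).tsum_add (t1.mul_left (ν + 1))]
  have hz : ν + 1 ≠ 0 := by linarith
  congr 1
  · simp only [pow_zero, Nat.factorial_zero, Nat.cast_one, Nat.cast_zero, zero_add, one_mul]
    rw [Real.Gamma_add_one hz]
    have := (Real.Gamma_pos_of_pos (show 0 < ν + 1 by linarith)).ne'
    field_simp
  · refine tsum_congr fun m => ?_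
    have hp : (0 : ℝ) < (m : ℝ) + ν + 2 := by linarith [(Nat.cast_nonneg m : (0 : ℝ) ≤ m)]
    have g1 : (m : ℝ) + (ν + 1 + 1) + 1 = ((m : ℝ) + ν + 2) + 1 := by ring
    have g2 : ((m + 1 : ℕ) : ℝ) + (ν + 1) + 1 = ((m : ℝ) + ν + 2) + 1 := by push_cast; ring
    have g3 : ((m + 1 : ℕ) : ℝ) + ν + 1 = (m : ℝ) + ν + 2 := by push_cast; ring
    rw [g1, g2, g3, Real.Gamma_add_one hp.ne', Nat.factorial_succ]
    have := (Real.Gamma_pos_of_pos hp).ne'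
    have hm : (m.factorial : ℝ) ≠ 0 := by positivity
    have hm' : (m : ℝ) + 1 ≠ 0 := by positivity
    push_cast
    field_simp
    ring

theorem besselSeries_pos {ν : ℝ} (hν : -1 < ν) {w : ℝ} (hw : 0 ≤ w) : 0 < besselSeries ν w := by
  refine (summable_besselSeries hν w).tsum_pos
    (fun m => div_nonneg (pow_nonneg hw m)
      (mul_pos (by positivity) (Gamma_natCast_add_pos hν m)).le) 0 ?_
  have := Gamma_natCast_add_pos hν 0
  simpa using this

theorem besselSeries_monotoneOn {ν : ℝ} (hν : -1 < ν) : MonotoneOn (besselSeries ν) (Ici 0) := by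
  refine monotoneOn_of_deriv_nonneg (convex_Ici 0) (continuous_besselSeries hν).continuousOn
    (fun w _ => (hasDerivAt_besselSeries hν w).differentiableAt.differentiableWithinAt)
    fun w hw => ?_
  rw [interior_Ici] at hw
  rw [(hasDerivAt_besselSeries hν w).deriv]
  exact (besselSeries_pos (by linarith) (le_of_lt hw)).le

theorem besselJ_eq (ν : ℝ) {x : ℝ} (hx : 0 < x) :
    besselJ ν x = (x / 2) ^ ν * besselSeries ν (-(x ^ 2 / 4)) := by
  rw [besselJ, besselSeries, ← tsum_mul_left]
  refine tsum_congr fun m => ?_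
  have h : (x / 2) ^ (2 * (m : ℝ)) = (x ^ 2 / 4) ^ m := by
    rw [mul_comm, Real.rpow_mul (by positivity), Real.rpow_natCast, Real.rpow_two, ← pow_mul,
      mul_comm, pow_mul]
    ring
  rw [Real.rpow_add (by positivity), h, neg_pow (x ^ 2 / 4)]
  ring

theorem besselI_eq (ν : ℝ) {x : ℝ} (hx : 0 < x) :
    besselI ν x = (x / 2) ^ ν * besselSeries ν (x ^ 2 / 4) := by
  rw [besselI, besselSeries, ← tsum_mul_left]
  refine tsum_congr fun m => ?_
  have h : (x / 2) ^ (2 * (m : ℝ)) = (x ^ 2 / 4) ^ m := by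
    rw [mul_comm, Real.rpow_mul (by positivity), Real.rpow_natCast, Real.rpow_two, ← pow_mul,
      mul_comm, pow_mul]
    ring
  rw [Real.rpow_add (by positivity), h]
  ring

/-- A positive increasing solution of a Schrödinger equation `h'' = q h` on `(0,1)`, vanishing
at `0`: the only features of it that the Green kernel depends on. -/
structure IsGroundState (h : ℝ → ℝ) : Prop where
  cont : Continuous h
  mono : MonotoneOn h (Icc 0 1)
  pos : ∀ x ∈ Ioc (0 : ℝ) 1, 0 < h x
  zero : h 0 = 0

/-- `∫_m^1 h⁻²`. -/
noncomputable def greenTail (h : ℝ → ℝ) (m : ℝ) : ℝ := ∫ r in m..1, (h r ^ 2)⁻¹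

/-- The Green kernel on `(0,1)` with ground state `h` and a Dirichlet condition at `1`. -/
noncomputable def greenKer (h : ℝ → ℝ) (x y : ℝ) : ℝ := h x * h y * greenTail h (max x y)

theorem greenKer_comm (h : ℝ → ℝ) (x y : ℝ) : greenKer h x y = greenKer h y x := by
  rw [greenKer, greenKer, max_comm, mul_comm (h x)]

theorem greenTail_one (h : ℝ → ℝ) : greenTail h 1 = 0 := by simp [greenTail]

namespace IsGroundState

variable {h : ℝ → ℝ}

theorem nonneg (H : IsGroundState h) {x : ℝ} (hx : x ∈ Icc (0 : ℝ) 1) : 0 ≤ h x := by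
  rcases hx.1.eq_or_lt with h0 | h0
  · rw [← h0, H.zero]
  · exact (H.pos x ⟨h0, hx.2⟩).le

theorem continuousAt_inv_sq (H : IsGroundState h) {x : ℝ} (hx : x ∈ Ioc (0 : ℝ) 1) :
    ContinuousAt (fun r => (h r ^ 2)⁻¹) x :=
  ((H.cont.pow 2).continuousAt).inv₀ (pow_pos (H.pos x hx) 2).ne'

theorem intervalIntegrable_inv_sq (H : IsGroundState h) {m : ℝ} (hm : m ∈ Ioc (0 : ℝ) 1) :
    IntervalIntegrable (fun r => (h r ^ 2)⁻¹) volume m 1 := by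
  refine ContinuousOn.intervalIntegrable fun r hr => ?_
  rw [uIcc_of_le hm.2] at hr
  exact (H.continuousAt_inv_sq ⟨hm.1.trans_le hr.1, hr.2⟩).continuousWithinAt

theorem hasDerivAt_greenTail (H : IsGroundState h) {m : ℝ} (hm : m ∈ Ioc (0 : ℝ) 1) :
    HasDerivAt (greenTail h) (-(h m ^ 2)⁻¹) m :=
  intervalIntegral.integral_hasDerivAt_left (H.intervalIntegrable_inv_sq hm)
    ((H.cont.measurable.pow_const 2).inv.stronglyMeasurable.stronglyMeasurableAtFilter)
    (H.continuousAt_inv_sq hm)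

theorem greenTail_nonneg {m : ℝ} (hm : m ≤ 1) : 0 ≤ greenTail h m :=
  intervalIntegral.integral_nonneg hm fun _ _ => inv_nonneg.2 (sq_nonneg _)

theorem greenKer_nonneg (H : IsGroundState h) {x y : ℝ} (hx : x ∈ Icc (0 : ℝ) 1)
    (hy : y ∈ Icc (0 : ℝ) 1) : 0 ≤ greenKer h x y :=
  mul_nonneg (mul_nonneg (H.nonneg hx) (H.nonneg hy)) (greenTail_nonneg (max_le hx.2 hy.2))

theorem greenKer_le_one (H : IsGroundState h) {x y : ℝ} (hx : x ∈ Icc (0 : ℝ) 1)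
    (hy : y ∈ Ioc (0 : ℝ) 1) : greenKer h x y ≤ 1 := by
  have hy' : y ∈ Icc (0 : ℝ) 1 := ⟨hy.1.le, hy.2⟩
  have hm : max x y ∈ Ioc (0 : ℝ) 1 := ⟨lt_max_of_lt_right hy.1, max_le hx.2 hy.2⟩
  rw [greenKer, greenTail, ← intervalIntegral.integral_const_mul]
  calc ∫ r in (max x y)..1, h x * h y * (h r ^ 2)⁻¹ ≤ ∫ r in (max x y)..1, (1 : ℝ) := by
        refine intervalIntegral.integral_mono_on hm.2
          ((H.intervalIntegrable_inv_sq hm).const_mul _) (by simp) fun r hr => ?_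
        have hr1 : r ∈ Icc (0 : ℝ) 1 := ⟨hm.1.le.trans hr.1, hr.2⟩
        have hpos : 0 < h r := H.pos r ⟨hm.1.trans_le hr.1, hr.2⟩
        have h1 := H.mono hx hr1 ((le_max_left x y).trans hr.1)
        have h2 := H.mono hy' hr1 ((le_max_right x y).trans hr.1)
        rw [← div_eq_mul_inv, div_le_one (by positivity), sq]
        exact mul_le_mul h1 h2 (H.nonneg hy') hpos.le
    _ ≤ 1 := by
        rw [intervalIntegral.integral_const, smul_eq_mul, mul_one]
        linarith [hm.1]

theorem continuousOn_greenKer (H : IsGroundState h) :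
    ContinuousOn (fun p : ℝ × ℝ => greenKer h p.1 p.2) (Icc 0 1 ×ˢ Ioc 0 1) := by
  intro p hp
  have hm : max p.1 p.2 ∈ Ioc (0 : ℝ) 1 := ⟨lt_max_of_lt_right hp.2.1, max_le hp.1.2 hp.2.2⟩
  have h1 : ContinuousAt (fun p : ℝ × ℝ => greenTail h (max p.1 p.2)) p :=
    ContinuousAt.comp (f := fun p : ℝ × ℝ => max p.1 p.2)
      (H.hasDerivAt_greenTail hm).continuousAt (by fun_prop)
  have h2 : ContinuousAt (fun p : ℝ × ℝ => h p.1 * h p.2) p :=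
    ((H.cont.comp continuous_fst).mul (H.cont.comp continuous_snd)).continuousAt
  exact (h2.mul h1).continuousWithinAt

end IsGroundState

/-- Lebesgue measure on `(0,1]`. -/
noncomputable abbrev unitMeas : Measure ℝ := volume.restrict (Ioc 0 1)

/-- The real Hilbert space `L²(0,1)`. -/
abbrev L2Unit : Type := Lp ℝ 2 unitMeas

instance : IsProbabilityMeasure unitMeas := ⟨by simp [unitMeas]⟩

theorem inner_L2Unit (f g : L2Unit) : inner ℝ f g = ∫ x in Ioc (0 : ℝ) 1, f x * g x := by
  rw [MeasureTheory.L2.inner_def]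
  simp [mul_comm]

theorem memLp_two_of_abs_le {f : ℝ → ℝ} {C : ℝ} (hf : AEStronglyMeasurable f unitMeas)
    (hC : ∀ x ∈ Ioc (0 : ℝ) 1, |f x| ≤ C) : MemLp f 2 unitMeas :=
  MemLp.of_bound hf C ((ae_restrict_iff' measurableSet_Ioc).2 (.of_forall fun x hx => hC x hx))

theorem integrable_L2Unit (f : L2Unit) : Integrable f unitMeas :=
  (Lp.memLp f).integrable (by norm_num)

theorem norm_toLp_le {f : ℝ → ℝ} (hf : MemLp f 2 unitMeas) {C : ℝ} (hC0 : 0 ≤ C)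
    (hC : ∀ x ∈ Ioc (0 : ℝ) 1, |f x| ≤ C) : ‖hf.toLp f‖ ≤ C := by
  refine (Lp.norm_le_of_ae_bound (C := C) hC0 ?_).trans (by simp [measureUnivNNReal])
  filter_upwards [hf.coeFn_toLp, ae_restrict_mem measurableSet_Ioc] with x hx hx'
  rw [hx]
  exact hC x hx'

open Classical in
/-- The section `k(x, ·)` of the Green kernel, as an element of `L²(0,1)`. -/
noncomputable def greenVec (h : ℝ → ℝ) (x : ℝ) : L2Unit :=
  if hx : MemLp (greenKer h x) 2 unitMeas then hx.toLp _ else 0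

namespace IsGroundState

variable {h : ℝ → ℝ}

theorem abs_greenKer_le_one (H : IsGroundState h) {x y : ℝ} (hx : x ∈ Icc (0 : ℝ) 1)
    (hy : y ∈ Ioc (0 : ℝ) 1) : |greenKer h x y| ≤ 1 := by
  rw [abs_of_nonneg (H.greenKer_nonneg hx ⟨hy.1.le, hy.2⟩)]
  exact H.greenKer_le_one hx hy

theorem memLp_greenKer (H : IsGroundState h) {x : ℝ} (hx : x ∈ Icc (0 : ℝ) 1) :
    MemLp (greenKer h x) 2 unitMeas := by
  refine memLp_two_of_abs_le (C := 1) ?_ fun y hy => H.abs_greenKer_le_one hx hy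
  refine ContinuousOn.aestronglyMeasurable ?_ measurableSet_Ioc
  exact H.continuousOn_greenKer.comp (f := fun y => (x, y)) (by fun_prop) fun y hy => ⟨hx, hy⟩

theorem greenVec_eq (H : IsGroundState h) {x : ℝ} (hx : x ∈ Icc (0 : ℝ) 1) :
    greenVec h x = (H.memLp_greenKer hx).toLp _ := by
  rw [greenVec, dif_pos]

theorem coeFn_greenVec (H : IsGroundState h) {x : ℝ} (hx : x ∈ Icc (0 : ℝ) 1) :
    greenVec h x =ᵐ[unitMeas] greenKer h x := by
  rw [H.greenVec_eq hx]
  exact MemLp.coeFn_toLp _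

theorem norm_greenVec_le (H : IsGroundState h) {x : ℝ} (hx : x ∈ Icc (0 : ℝ) 1) :
    ‖greenVec h x‖ ≤ 1 := by
  rw [H.greenVec_eq hx]
  exact norm_toLp_le _ zero_le_one fun y hy => H.abs_greenKer_le_one hx hy

theorem inner_greenVec (H : IsGroundState h) {x : ℝ} (hx : x ∈ Icc (0 : ℝ) 1) (f : L2Unit) :
    inner ℝ (greenVec h x) f = ∫ y in Ioc (0 : ℝ) 1, greenKer h x y * f y := by
  rw [inner_L2Unit]
  refine integral_congr_ae ?_
  filter_upwards [H.coeFn_greenVec hx] with y hy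
  rw [hy]

theorem continuousOn_greenVec (H : IsGroundState h) : ContinuousOn (greenVec h) (Icc 0 1) := by
  intro x hx
  rw [ContinuousWithinAt, tendsto_iff_norm_sub_tendsto_zero]
  have key : Tendsto (fun b => ∫ y in Ioc (0 : ℝ) 1, (greenKer h b y - greenKer h x y) ^ 2)
      (𝓝[Icc 0 1] x) (𝓝 (∫ _ in Ioc (0 : ℝ) 1, (0 : ℝ))) := by
    refine tendsto_integral_filter_of_dominated_convergence (fun _ => 4) ?_ ?_
      (integrable_const _) ?_
    · filter_upwards [self_mem_nhdsWithin] with b hb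
      exact (((H.memLp_greenKer hb).1).sub (H.memLp_greenKer hx).1).pow 2
    · filter_upwards [self_mem_nhdsWithin] with b hb
      filter_upwards [ae_restrict_mem measurableSet_Ioc] with y hy
      have h1 := abs_le.1 (H.abs_greenKer_le_one hb hy)
      have h2 := abs_le.1 (H.abs_greenKer_le_one hx hy)
      rw [Real.norm_of_nonneg (sq_nonneg _)]
      nlinarith
    · filter_upwards [ae_restrict_mem measurableSet_Ioc] with y hy
      have h1 : ContinuousOn (fun b => greenKer h b y) (Icc 0 1) :=
        H.continuousOn_greenKer.comp (f := fun b => (b, y)) (by fun_prop) fun b hb => ⟨hb, hy⟩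
      have h2 : Tendsto (fun b => (greenKer h b y - greenKer h x y) ^ 2) (𝓝[Icc 0 1] x)
          (𝓝 ((greenKer h x y - greenKer h x y) ^ 2)) :=
        (Tendsto.sub (h1 x hx) tendsto_const_nhds).pow 2
      simpa using h2
  rw [integral_zero] at key
  have h3 := (Real.continuous_sqrt.tendsto 0).comp key
  rw [Real.sqrt_zero] at h3
  refine h3.congr' ?_
  filter_upwards [self_mem_nhdsWithin] with b hb
  rw [Function.comp_apply, norm_eq_sqrt_real_inner, inner_L2Unit]
  congr 1
  refine integral_congr_ae ?_
  filter_upwards [H.coeFn_greenVec hb, H.coeFn_greenVec hx,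
    Lp.coeFn_sub (greenVec h b) (greenVec h x)] with y h1 h2 h3
  rw [h3, Pi.sub_apply, h1, h2, sq]

theorem continuousOn_inner_greenVec (H : IsGroundState h) (f : L2Unit) :
    ContinuousOn (fun x => inner ℝ (greenVec h x) f) (Icc 0 1) :=
  H.continuousOn_greenVec.inner continuousOn_const

theorem abs_inner_greenVec_le (H : IsGroundState h) (f : L2Unit) {x : ℝ}
    (hx : x ∈ Icc (0 : ℝ) 1) : |inner ℝ (greenVec h x) f| ≤ ‖f‖ :=
  (abs_real_inner_le_norm _ _).trans
    (mul_le_of_le_one_left (norm_nonneg _) (H.norm_greenVec_le hx))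

theorem memLp_inner_greenVec (H : IsGroundState h) (f : L2Unit) :
    MemLp (fun x => inner ℝ (greenVec h x) f) 2 unitMeas :=
  memLp_two_of_abs_le
    (((H.continuousOn_inner_greenVec f).mono Ioc_subset_Icc_self).aestronglyMeasurable
      measurableSet_Ioc)
    fun _ hx => H.abs_inner_greenVec_le f (Ioc_subset_Icc_self hx)

/-- The Green operator on `L²(0,1)`. -/
noncomputable def greenOp (H : IsGroundState h) : L2Unit →L[ℝ] L2Unit :=
  LinearMap.mkContinuous
    { toFun := fun f => (H.memLp_inner_greenVec f).toLp _
      map_add' := fun f g => by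
        rw [← MemLp.toLp_add]
        congr 1
        funext x
        exact inner_add_right _ _ _
      map_smul' := fun c f => by
        rw [RingHom.id_apply, ← MemLp.toLp_const_smul]
        congr 1
        funext x
        exact inner_smul_right _ _ _ } 1
    fun f => by
      rw [one_mul]
      exact norm_toLp_le (H.memLp_inner_greenVec f) (norm_nonneg _)
        fun _ hx => H.abs_inner_greenVec_le f (Ioc_subset_Icc_self hx)

theorem greenOp_apply (H : IsGroundState h) (f : L2Unit) :
    H.greenOp f = (H.memLp_inner_greenVec f).toLp _ := rfl

theorem coeFn_greenOp (H : IsGroundState h) (f : L2Unit) :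
    H.greenOp f =ᵐ[unitMeas] fun x => inner ℝ (greenVec h x) f :=
  MemLp.coeFn_toLp (H.memLp_inner_greenVec f)

theorem isSymmetric_greenOp (H : IsGroundState h) : H.greenOp.IsSymmetric := by
  intro f g
  have e (f g : L2Unit) : inner ℝ (H.greenOp f) g =
      ∫ x in Ioc (0 : ℝ) 1, ∫ y in Ioc (0 : ℝ) 1, greenKer h x y * f y * g x := by
    rw [inner_L2Unit]
    refine integral_congr_ae ?_
    filter_upwards [H.coeFn_greenOp f, ae_restrict_mem measurableSet_Ioc] with x hx hx'
    rw [hx, H.inner_greenVec (Ioc_subset_Icc_self hx'), integral_mul_const]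
  have hint : Integrable (Function.uncurry fun x y => greenKer h x y * f y * g x)
      (unitMeas.prod unitMeas) := by
    have h1 : Integrable (fun p : ℝ × ℝ => g p.1 * f p.2) (unitMeas.prod unitMeas) :=
      (integrable_L2Unit g).mul_prod (integrable_L2Unit f)
    have h2 : Integrable (fun p : ℝ × ℝ => greenKer h p.1 p.2 * (g p.1 * f p.2))
        (unitMeas.prod unitMeas) := by
      refine h1.bdd_mul (c := 1) ?_ ?_
      · rw [Measure.prod_restrict]
        exact (H.continuousOn_greenKer.mono
          (prod_mono_left Ioc_subset_Icc_self)).aestronglyMeasurable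
          (measurableSet_Ioc.prod measurableSet_Ioc)
      · rw [Measure.prod_restrict]
        filter_upwards [ae_restrict_mem (measurableSet_Ioc.prod measurableSet_Ioc)] with p hp
        exact H.abs_greenKer_le_one (Ioc_subset_Icc_self hp.1) hp.2
    refine h2.congr (.of_forall fun p => ?_)
    simp only [Function.uncurry]
    ring
  calc inner ℝ (H.greenOp f) g
      = ∫ x in Ioc (0 : ℝ) 1, ∫ y in Ioc (0 : ℝ) 1, greenKer h x y * f y * g x := e f g
    _ = ∫ y in Ioc (0 : ℝ) 1, ∫ x in Ioc (0 : ℝ) 1, greenKer h x y * f y * g x :=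
        integral_integral_swap hint
    _ = inner ℝ (H.greenOp g) f := by
        rw [e]
        refine integral_congr_ae (.of_forall fun y => integral_congr_ae (.of_forall fun x => ?_))
        simp only [greenKer_comm h x y]
        ring
    _ = inner ℝ f (H.greenOp g) := real_inner_comm _ _

theorem isCompactOperator_greenOp (H : IsGroundState h) : IsCompactOperator H.greenOp := by
  have hK : IsCompact (greenVec h '' Icc 0 1) := isCompact_Icc.image_of_continuousOn
    H.continuousOn_greenVec
  suffices H.greenOp ∈ closure {T : L2Unit →L[ℝ] L2Unit | IsCompactOperator T} by
    rwa [isClosed_setOfPred_isCompactOperator.closure_eq] at this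
  rw [Metric.mem_closure_iff]
  intro ε hε
  obtain ⟨t, htf, ht⟩ := Metric.totallyBounded_iff.1 hK.totallyBounded (ε / 2) (by positivity)
  let V := Submodule.span ℝ t
  have : FiniteDimensional ℝ V := FiniteDimensional.span_of_finite ℝ htf
  refine ⟨H.greenOp.comp V.starProjection, ?_, ?_⟩
  · have : ProperSpace V := FiniteDimensional.proper_real V
    exact (isCompactOperator_of_locallyCompactSpace_rng
      (H.greenOp.comp V.subtypeL)).comp_clm V.orthogonalProjectionOnto
  · rw [dist_eq_norm]
    refine (ContinuousLinearMap.opNorm_le_bound _ (half_pos hε).le fun f => ?_).trans_lt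
      (half_lt_self hε)
    have hg : (H.greenOp - H.greenOp.comp V.starProjection) f =
        H.greenOp (f - V.starProjection f) := by simp
    have hn : ‖f - V.starProjection f‖ ≤ ‖f‖ := by
      rw [← Submodule.starProjection_orthogonal_val]
      exact Submodule.norm_starProjection_apply_le _ _
    rw [hg, H.greenOp_apply]
    refine norm_toLp_le _ (by positivity) fun x hx => ?_
    obtain ⟨v, hv, hxv⟩ := mem_iUnion₂.1 (ht (mem_image_of_mem _ (Ioc_subset_Icc_self hx)))
    have h0 : inner ℝ v (f - V.starProjection f) = 0 := by
      rw [real_inner_comm]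
      exact V.starProjection_inner_eq_zero f v (Submodule.subset_span hv)
    have h1 : inner ℝ (greenVec h x) (f - V.starProjection f) =
        inner ℝ (greenVec h x - v) (f - V.starProjection f) := by
      rw [inner_sub_left (greenVec h x), h0, sub_zero]
    rw [h1]
    refine (abs_real_inner_le_norm _ _).trans ?_
    rw [Metric.mem_ball, dist_eq_norm] at hxv
    gcongr

theorem greenOp_nonneg (H : IsGroundState h) {f : L2Unit} (hf : 0 ≤ᵐ[unitMeas] f) :
    0 ≤ᵐ[unitMeas] H.greenOp f := by
  filter_upwards [H.coeFn_greenOp f, ae_restrict_mem measurableSet_Ioc] with x hx hx'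
  have hx1 := Ioc_subset_Icc_self hx'
  rw [hx, H.inner_greenVec hx1]
  refine integral_nonneg_of_ae ?_
  filter_upwards [hf, ae_restrict_mem measurableSet_Ioc] with y hy hy'
  exact mul_nonneg (H.greenKer_nonneg hx1 (Ioc_subset_Icc_self hy')) hy

end IsGroundState

/-- `h * g` solves `(h g)'' = (q + c) h g` and is regular at `0`, where `h'' = q h`; expressed in
terms of `g` only. -/
structure IsRegularSolution (h : ℝ → ℝ) (c : ℝ) (g : ℝ → ℝ) : Prop where
  cont : Continuous g
  hasDerivAt : ∀ x ∈ Ioc (0 : ℝ) 1,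
    HasDerivAt g (c * (∫ t in (0 : ℝ)..x, h t ^ 2 * g t) / h x ^ 2) x

namespace IsGroundState

variable {h : ℝ → ℝ}

theorem continuousOn_greenTail (H : IsGroundState h) : ContinuousOn (greenTail h) (Ioc 0 1) :=
  fun _ hx => (H.hasDerivAt_greenTail hx).continuousAt.continuousWithinAt

theorem integrable_greenKer_mul (H : IsGroundState h) {x : ℝ} (hx : x ∈ Icc (0 : ℝ) 1)
    {f : ℝ → ℝ} (hf : Integrable f unitMeas) :
    Integrable (fun y => greenKer h x y * f y) unitMeas :=
  hf.bdd_mul (c := 1) (H.memLp_greenKer hx).aestronglyMeasurable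
    ((ae_restrict_iff' measurableSet_Ioc).2 (.of_forall fun _ hy => H.abs_greenKer_le_one hx hy))

theorem integral_greenKer_mul (H : IsGroundState h) {x : ℝ} (hx : x ∈ Ioc (0 : ℝ) 1)
    {f : ℝ → ℝ} (hf : Integrable f unitMeas) :
    ∫ y in Ioc (0 : ℝ) 1, greenKer h x y * f y =
      h x * (greenTail h x * (∫ y in (0 : ℝ)..x, h y * f y) +
        ∫ y in x..1, greenTail h y * (h y * f y)) := by
  have hI := H.integrable_greenKer_mul ⟨hx.1.le, hx.2⟩ hf
  have hI' : IntervalIntegrable (fun y => greenKer h x y * f y) volume 0 1 :=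
    (intervalIntegrable_iff_integrableOn_Ioc_of_le zero_le_one).2 hI
  have h0x : IntervalIntegrable (fun y => greenKer h x y * f y) volume 0 x :=
    hI'.mono_set (by rw [uIcc_of_le hx.1.le, uIcc_of_le zero_le_one]
                     exact Icc_subset_Icc_right hx.2)
  have hx1 : IntervalIntegrable (fun y => greenKer h x y * f y) volume x 1 :=
    hI'.mono_set (by rw [uIcc_of_le hx.2, uIcc_of_le zero_le_one]
                     exact Icc_subset_Icc_left hx.1.le)
  rw [← intervalIntegral.integral_of_le zero_le_one,
    ← intervalIntegral.integral_add_adjacent_intervals h0x hx1, mul_add, ← mul_assoc,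
    ← intervalIntegral.integral_const_mul, ← intervalIntegral.integral_const_mul]
  congr 1
  · refine intervalIntegral.integral_congr fun y hy => ?_
    rw [uIcc_of_le hx.1.le] at hy
    simp only [greenKer, max_eq_left hy.2]
    ring
  · refine intervalIntegral.integral_congr fun y hy => ?_
    rw [uIcc_of_le hx.2] at hy
    simp only [greenKer, max_eq_right hy.1]
    ring

theorem hasDerivAt_integral_sq_mul (H : IsGroundState h) {g : ℝ → ℝ} (hg : Continuous g) (x : ℝ) :
    HasDerivAt (fun x => ∫ t in (0 : ℝ)..x, h t ^ 2 * g t) (h x ^ 2 * g x) x := by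
  have hc : Continuous fun t => h t ^ 2 * g t := (H.cont.pow 2).mul hg
  exact intervalIntegral.integral_hasDerivAt_right (hc.intervalIntegrable _ _)
    (hc.stronglyMeasurableAtFilter _ _) hc.continuousAt

theorem integrable_unitMeas {g : ℝ → ℝ} (hg : Continuous g) : Integrable g unitMeas :=
  (hg.integrableOn_Icc (a := 0) (b := 1)).mono_set Ioc_subset_Icc_self

/-- The Green operator inverts the Schrödinger operator on regular solutions. -/
theorem mul_integral_greenKer_regularSolution (H : IsGroundState h) {c : ℝ} {g : ℝ → ℝ}
    (hg : IsRegularSolution h c g) {x : ℝ} (hx : x ∈ Ioc (0 : ℝ) 1) :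
    c * ∫ y in Ioc (0 : ℝ) 1, greenKer h x y * (h y * g y) = h x * (g 1 - g x) := by
  have hc : Continuous fun y => h y * g y := H.cont.mul hg.cont
  rw [H.integral_greenKer_mul hx (integrable_unitMeas hc)]
  set P : ℝ → ℝ := fun x => ∫ t in (0 : ℝ)..x, h t ^ 2 * g t with hP
  have hsub : uIcc x 1 ⊆ Ioc 0 1 := by
    rw [uIcc_of_le hx.2]
    exact fun r hr => ⟨hx.1.trans_le hr.1, hr.2⟩
  have key : ∫ y in x..1, c * (greenTail h y * (h y * (h y * g y))) =
      (c * (P 1 * greenTail h 1) + g 1) - (c * (P x * greenTail h x) + g x) := by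
    refine intervalIntegral.integral_eq_sub_of_hasDerivAt
      (f := fun y => c * (P y * greenTail h y) + g y) (fun y hy => ?_) ?_
    · have hy' := hsub hy
      have := (((H.hasDerivAt_integral_sq_mul hg.cont y).mul
        (H.hasDerivAt_greenTail hy')).const_mul c).add (hg.hasDerivAt y hy')
      refine this.congr_deriv ?_
      have := (H.pos y hy').ne'
      field_simp
      ring
    · refine ContinuousOn.intervalIntegrable ?_
      exact continuousOn_const.mul ((H.continuousOn_greenTail.mono hsub).mul
        (H.cont.mul hc).continuousOn)
  rw [intervalIntegral.integral_const_mul, greenTail_one] at key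
  have e : ∫ y in (0 : ℝ)..x, h y * (h y * g y) = P x := by
    simp only [hP]
    congr 1
    ext y
    ring
  rw [e]
  linear_combination h x * key

/-- Backward uniqueness for the first order system satisfied by a solution and its momentum. -/
theorem eq_zero_of_system (H : IsGroundState h) {c : ℝ} {q p : ℝ → ℝ}
    (hq : ContinuousOn q (Ioc 0 1)) (hp : ContinuousOn p (Ioc 0 1))
    (hq' : ∀ x ∈ Ioo (0 : ℝ) 1, HasDerivAt q (c * p x / h x ^ 2) x)
    (hp' : ∀ x ∈ Ioo (0 : ℝ) 1, HasDerivAt p (h x ^ 2 * q x) x)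
    (hq1 : q 1 = 0) (hp1 : p 1 = 0) {x : ℝ} (hx : x ∈ Ioc (0 : ℝ) 1) : q x = 0 ∧ p x = 0 := by
  set M : ℝ := h 1 ^ 2 + |c| / h x ^ 2
  have hx0 := H.pos x hx
  have hmono : MonotoneOn (fun r => (q r ^ 2 + p r ^ 2) * exp (M * r)) (Icc x 1) := by
    refine monotoneOn_of_deriv_nonneg (convex_Icc x 1) ?_ ?_ ?_
    · have hs : Icc x 1 ⊆ Ioc 0 1 := fun r hr => ⟨hx.1.trans_le hr.1, hr.2⟩
      exact (((hq.mono hs).pow 2).add ((hp.mono hs).pow 2)).mul (by fun_prop)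
    all_goals
      rw [interior_Icc]
      intro r hr
      have hr' : r ∈ Ioo (0 : ℝ) 1 := ⟨hx.1.trans hr.1, hr.2⟩
      have hd := (((hq' r hr').pow 2).add ((hp' r hr').pow 2)).mul
        (((hasDerivAt_id r).const_mul M).exp)
    · exact hd.differentiableAt.differentiableWithinAt
    · have hd' := hd.deriv
      simp only [Pi.add_apply, Pi.pow_apply, id] at hd'
      erw [hd']
      have hr1 : r ∈ Icc (0 : ℝ) 1 := ⟨hr'.1.le, hr'.2.le⟩
      have hhr : h x ≤ h r := H.mono ⟨hx.1.le, hx.2⟩ hr1 hr.1.le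
      have hhr1 : h r ≤ h 1 := H.mono hr1 (right_mem_Icc.2 zero_le_one) hr.2.le
      have b1 : |c / h r ^ 2| ≤ |c| / h x ^ 2 := by
        rw [abs_div, abs_of_nonneg (sq_nonneg (h r))]
        gcongr
      have b2 : h r ^ 2 ≤ h 1 ^ 2 := by gcongr; exact hx0.le.trans hhr
      have b3 : |2 * (q r * p r)| ≤ q r ^ 2 + p r ^ 2 := by
        rw [abs_le]
        constructor <;> nlinarith [sq_nonneg (q r + p r), sq_nonneg (q r - p r)]
      have b4 : |(c / h r ^ 2 + h r ^ 2) * (2 * (q r * p r))| ≤ M * (q r ^ 2 + p r ^ 2) := by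
        rw [abs_mul]
        refine mul_le_mul ?_ b3 (abs_nonneg _) (by positivity)
        refine (abs_add_le _ _).trans ?_
        rw [abs_of_nonneg (sq_nonneg (h r))]
        linarith
      have b5 := (abs_le.1 b4).1
      have : 0 ≤ ((c / h r ^ 2 + h r ^ 2) * (2 * (q r * p r)) + M * (q r ^ 2 + p r ^ 2)) *
        exp (M * r) := mul_nonneg (by linarith) (exp_pos _).le
      convert this using 1
      simp
      ring
  have h1 := hmono (left_mem_Icc.2 hx.2) (right_mem_Icc.2 hx.2) hx.2
  simp only [hq1, hp1] at h1
  have h2 : q x ^ 2 + p x ^ 2 ≤ 0 := by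
    by_contra hcon
    have := mul_pos (not_le.1 hcon) (exp_pos (M * x))
    norm_num at h1
    linarith
  constructor <;> nlinarith [sq_nonneg (q x), sq_nonneg (p x)]

end IsGroundState

namespace IsGroundState

variable {h : ℝ → ℝ}

/-- Every eigenfunction of the Green operator is a multiple of the regular solution. -/
theorem eigenvector_greenOp (H : IsGroundState h) {θ : ℝ} (hθ : θ ≠ 0) {f : L2Unit}
    (hf : H.greenOp f = θ • f) {g : ℝ → ℝ} (hg : IsRegularSolution h (-θ⁻¹) g) (hg0 : g 0 ≠ 0) :
    f = 0 ∨ g 1 = 0 ∧ ∃ b : ℝ, f =ᵐ[unitMeas] fun x => b * (h x * g x) := by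
  set c : ℝ := -θ⁻¹ with hc
  set u : ℝ → ℝ := fun x => θ⁻¹ * inner ℝ (greenVec h (projIcc 0 1 zero_le_one x)) f with hu
  have hu_cont : Continuous u := by
    refine continuous_const.mul ?_
    exact (H.continuousOn_inner_greenVec f).comp_continuous
      (continuous_subtype_val.comp continuous_projIcc) fun x => (projIcc _ _ _ x).2
  have hfu : f =ᵐ[unitMeas] u := by
    have h1 := H.coeFn_greenOp f
    rw [hf] at h1
    filter_upwards [h1, Lp.coeFn_smul θ f, ae_restrict_mem measurableSet_Ioc] with x hx hx2 hx3
    simp only [hu, projIcc_of_mem zero_le_one (Ioc_subset_Icc_self hx3), ← hx, hx2, Pi.smul_apply,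
      smul_eq_mul]
    field_simp
  set p : ℝ → ℝ := fun x => ∫ y in (0 : ℝ)..x, h y * u y with hp
  set P : ℝ → ℝ := fun x => ∫ t in (0 : ℝ)..x, h t ^ 2 * g t with hP
  have hhu : Continuous fun y => h y * u y := H.cont.mul hu_cont
  have hp' (x : ℝ) : HasDerivAt p (h x * u x) x :=
    intervalIntegral.integral_hasDerivAt_right (hhu.intervalIntegrable _ _)
      (hhu.stronglyMeasurableAtFilter _ _) hhu.continuousAt
  have hP' := H.hasDerivAt_integral_sq_mul hg.cont
  have hu_eq : ∀ x ∈ Ioc (0 : ℝ) 1, u x =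
      h x * (θ⁻¹ * (greenTail h x * p x + ∫ y in x..1, greenTail h y * (h y * u y))) := by
    intro x hx
    have h1 : u x = θ⁻¹ * ∫ y in Ioc (0 : ℝ) 1, greenKer h x y * f y := by
      simp only [hu]
      rw [projIcc_of_mem zero_le_one (Ioc_subset_Icc_self hx),
        H.inner_greenVec (Ioc_subset_Icc_self hx)]
    have h2 : ∫ y in Ioc (0 : ℝ) 1, greenKer h x y * f y =
        ∫ y in Ioc (0 : ℝ) 1, greenKer h x y * u y := by
      refine integral_congr_ae ?_
      filter_upwards [hfu] with y hy
      rw [hy]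
    rw [h1, h2, H.integral_greenKer_mul hx (integrable_unitMeas hu_cont)]
    ring
  set q : ℝ → ℝ := fun x =>
    θ⁻¹ * (greenTail h x * p x + ∫ y in x..1, greenTail h y * (h y * u y)) with hq
  have hVhu : ContinuousOn (fun y => greenTail h y * (h y * u y)) (Ioc 0 1) :=
    H.continuousOn_greenTail.mul hhu.continuousOn
  have hq' : ∀ x ∈ Ioo (0 : ℝ) 1, HasDerivAt q (c * p x / h x ^ 2) x := by
    intro x hx
    have hx' := Ioo_subset_Ioc_self hx
    have hI : IntervalIntegrable (fun y => greenTail h y * (h y * u y)) volume x 1 := by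
      refine (hVhu.mono ?_).intervalIntegrable
      rw [uIcc_of_le hx.2.le]
      exact fun r hr => ⟨hx.1.trans_le hr.1, hr.2⟩
    have hd := (((H.hasDerivAt_greenTail hx').mul (hp' x)).add
      (intervalIntegral.integral_hasDerivAt_left hI
        ((hVhu.mono Ioo_subset_Ioc_self).stronglyMeasurableAtFilter isOpen_Ioo x hx)
        (((hVhu.mono Ioo_subset_Ioc_self)).continuousAt (isOpen_Ioo.mem_nhds hx)))).const_mul θ⁻¹
    refine hd.congr_deriv ?_
    rw [hc]
    ring
  have hq_cont : ContinuousOn q (Ioc 0 1) := by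
    have : ContinuousOn (fun x => u x / h x) (Ioc 0 1) :=
      hu_cont.continuousOn.div H.cont.continuousOn fun x hx => (H.pos x hx).ne'
    refine this.congr fun x hx => ?_
    have h1 : u x = h x * q x := hu_eq x hx
    simp only [h1]
    rw [mul_div_cancel_left₀ _ (H.pos x hx).ne']
  have hp_q : ∀ x ∈ Ioo (0 : ℝ) 1, HasDerivAt p (h x ^ 2 * q x) x := fun x hx => by
    refine (hp' x).congr_deriv ?_
    rw [hu_eq x (Ioo_subset_Ioc_self hx)]
    ring
  have hp_cont : Continuous p := continuous_iff_continuousAt.2 fun x => (hp' x).continuousAt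
  have hP_cont : Continuous P := continuous_iff_continuousAt.2 fun x => (hP' x).continuousAt
  have h01 : (1 : ℝ) ∈ Ioc (0 : ℝ) 1 := right_mem_Ioc.2 zero_lt_one
  have hq1 : q 1 = 0 := by simp [hq, greenTail_one]
  have hzero (hp1 : p 1 = 0) : f = 0 := by
    refine Lp.eq_zero_iff_ae_eq_zero.2 ?_
    filter_upwards [hfu, ae_restrict_mem measurableSet_Ioc] with x hx hx'
    rw [hx, hu_eq x hx']
    change h x * q x = 0
    rw [(H.eq_zero_of_system hq_cont hp_cont.continuousOn hq' hp_q hq1 hp1 hx').1, mul_zero]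
  have hcross : p 1 * g 1 = 0 := by
    obtain ⟨G, hG⟩ := isCompact_Icc.exists_bound_of_continuousOn (s := Icc (0 : ℝ) 1)
      hg.cont.continuousOn
    have hP_le : ∀ x ∈ Icc (0 : ℝ) 1, |P x| ≤ G * h x ^ 2 * x := by
      intro x hx
      have := intervalIntegral.norm_integral_le_of_norm_le_const (a := 0) (b := x)
        (f := fun t => h t ^ 2 * g t) (C := G * h x ^ 2) fun t ht => by
          rw [uIoc_of_le hx.1] at ht
          have ht' : t ∈ Icc (0 : ℝ) 1 := ⟨ht.1.le, ht.2.trans hx.2⟩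
          rw [norm_mul, mul_comm, Real.norm_of_nonneg (sq_nonneg (h t))]
          have h1 := hG t ht'
          have h2 := H.mono ht' hx ht.2
          have h3 := H.nonneg ht'
          have h4 : 0 ≤ G := (norm_nonneg _).trans h1
          gcongr
      simpa [abs_of_nonneg hx.1] using this
    set D : ℝ → ℝ := fun x => p x * g x - u x * (P x / h x) with hD
    have hD_cont : ContinuousOn D (Icc 0 1) := by
      refine (hp_cont.mul hg.cont).continuousOn.sub (hu_cont.continuousOn.mul fun x hx => ?_)
      rcases hx.1.eq_or_lt with h0 | h0
      · subst h0
        have hlim : Tendsto (fun x => G * h x * x) (𝓝[Icc 0 1] 0) (𝓝 0) := by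
          have hc : Continuous fun x => G * h x * x := (continuous_const.mul H.cont).mul continuous_id
          have := (hc.tendsto 0).mono_left (nhdsWithin_le_nhds (s := Icc (0 : ℝ) 1))
          simpa using this
        rw [ContinuousWithinAt, H.zero, div_zero]
        refine squeeze_zero_norm' ?_ hlim
        filter_upwards [self_mem_nhdsWithin] with x hx
        rcases (H.nonneg hx).eq_or_lt with e | e
        · simp [← e]
        · rw [norm_div, Real.norm_of_nonneg e.le, div_le_iff₀ e]
          refine (hP_le x hx).trans (le_of_eq ?_)
          ring
      · exact (hP_cont.continuousAt.div H.cont.continuousAt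
          (H.pos x ⟨h0, hx.2⟩).ne').continuousWithinAt
    have hD' : ∀ x ∈ Ioo (0 : ℝ) 1, HasDerivAt D 0 x := by
      intro x hx
      have hd := ((hp_q x hx).mul (hg.hasDerivAt x (Ioo_subset_Ioc_self hx))).sub
        ((hq' x hx).mul (hP' x))
      refine (hd.congr_deriv ?_).congr_of_eventuallyEq ?_
      · ring
      · filter_upwards [isOpen_Ioo.mem_nhds hx] with r hr
        have hr' := Ioo_subset_Ioc_self hr
        have := (H.pos r hr').ne'
        simp only [hD, Pi.sub_apply, Pi.mul_apply]
        rw [hu_eq r hr']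
        change _ - h r * q r * _ = _ - q r * P r
        field_simp
    obtain ⟨r, hr, hr'⟩ := exists_hasDerivAt_eq_slope D (fun _ => 0) zero_lt_one hD_cont hD'
    have hD0 : D 0 = 0 := by simp [hD, hp, hP]
    have hu1 : u 1 = 0 := by
      rw [hu_eq 1 h01]
      change h 1 * q 1 = 0
      rw [hq1, mul_zero]
    have hD1 : D 1 = p 1 * g 1 := by simp [hD, hu1]
    rw [hD0, hD1] at hr'
    linarith
  rcases mul_eq_zero.1 hcross with hp1 | hg1
  · exact Or.inl (hzero hp1)
  · have hg' : ∀ x ∈ Ioo (0 : ℝ) 1, HasDerivAt g (c * P x / h x ^ 2) x := fun x hx =>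
      hg.hasDerivAt x (Ioo_subset_Ioc_self hx)
    have hP1 : P 1 ≠ 0 := by
      intro hP1
      have hgz : ∀ x ∈ Ioc (0 : ℝ) 1, g x = 0 := fun x hx =>
        (H.eq_zero_of_system hg.cont.continuousOn hP_cont.continuousOn hg' (fun x _ => hP' x)
          hg1 hP1 hx).1
      refine hg0 ?_
      have h1 : Tendsto g (𝓝[Ioc 0 1] 0) (𝓝 (g 0)) := hg.cont.continuousAt.continuousWithinAt
      have h2 : Tendsto g (𝓝[Ioc 0 1] 0) (𝓝 0) :=
        tendsto_const_nhds.congr' (by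
          filter_upwards [self_mem_nhdsWithin] with x hx using (hgz x hx).symm)
      have : (𝓝[Ioc (0 : ℝ) 1] 0).NeBot := by
        rw [nhdsWithin_Ioc_eq_nhdsGT zero_lt_one]
        infer_instance
      exact tendsto_nhds_unique h1 h2
    refine Or.inr ⟨hg1, p 1 / P 1, ?_⟩
    filter_upwards [hfu, ae_restrict_mem measurableSet_Ioc] with x hx hx'
    set b := p 1 / P 1
    have := (H.eq_zero_of_system (q := fun x => q x - b * g x) (p := fun x => p x - b * P x) (c := c)
      (hq_cont.sub (hg.cont.continuousOn.const_smul b))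
      (hp_cont.continuousOn.sub (hP_cont.continuousOn.const_smul b))
      (fun x hx => ((hq' x hx).sub ((hg' x hx).const_mul b)).congr_deriv (by ring))
      (fun x hx => ((hp_q x hx).sub ((hP' x).const_mul b)).congr_deriv (by ring))
      (by simp [hq1, hg1]) (by simp only [b]; field_simp; ring) hx').1
    rw [hx, hu_eq x hx']
    change h x * q x = _
    have hqx : q x = b * g x := by linarith
    rw [hqx]
    ring

theorem greenOp_injective (H : IsGroundState h) {f : L2Unit} (hf : H.greenOp f = 0) : f = 0 := by
  have hzero : ∀ x ∈ Ioc (0 : ℝ) 1, inner ℝ (greenVec h x) f = 0 := by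
    have h1 := H.coeFn_greenOp f
    rw [hf] at h1
    refine Measure.eqOn_Ioc_of_ae_eq (μ := volume) (f := fun x => inner ℝ (greenVec h x) f)
      (g := fun _ => (0 : ℝ)) ?_
      ((H.continuousOn_inner_greenVec f).mono Ioc_subset_Icc_self) continuousOn_const
    filter_upwards [h1, Lp.coeFn_zero ℝ 2 unitMeas] with x hx hx'
    rw [← hx, hx', Pi.zero_apply]
  have hfi := integrable_L2Unit f
  have hhf : Integrable (fun y => h y * f y) unitMeas := by
    obtain ⟨C, hC⟩ := isCompact_Icc.exists_bound_of_continuousOn (s := Icc (0 : ℝ) 1)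
      H.cont.continuousOn
    exact hfi.bdd_mul (c := C) H.cont.aestronglyMeasurable
      ((ae_restrict_iff' measurableSet_Ioc).2
        (.of_forall fun x hx => hC x (Ioc_subset_Icc_self hx)))
  have hhfI : IntervalIntegrable (fun y => h y * f y) volume 0 1 :=
    (intervalIntegrable_iff_integrableOn_Ioc_of_le zero_le_one).2 hhf
  set p : ℝ → ℝ := fun x => ∫ y in (0 : ℝ)..x, h y * f y with hp
  have hdp : ∀ᵐ x, x ∈ Icc (0 : ℝ) 1 → HasDerivAt p (h x * f x) x := by
    filter_upwards [hhfI.ae_hasDerivAt_integral] with x hx hx'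
    rw [uIcc_of_le zero_le_one] at hx
    exact hx hx' 0 (left_mem_Icc.2 zero_le_one)
  have hp_cont : ContinuousOn p (Icc 0 1) := by
    have := intervalIntegral.continuousOn_primitive_interval (μ := volume) (a := 0) (b := 1)
      (f := fun y => h y * f y) (by
        rw [uIcc_of_le zero_le_one, integrableOn_Icc_iff_integrableOn_Ioc]
        exact hhf)
    rwa [uIcc_of_le zero_le_one] at this
  have hp0 : ∀ ε ∈ Ioo (0 : ℝ) 1, ∀ x ∈ Ioo ε 1, p x = 0 := by
    intro ε hε
    have hs : Icc ε 1 ⊆ Ioc 0 1 := fun r hr => ⟨hε.1.trans_le hr.1, hr.2⟩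
    have hV : IntervalIntegrable (fun y => greenTail h y * (h y * f y)) volume ε 1 := by
      refine (hhfI.mono_set ?_).continuousOn_mul ?_
      · rw [uIcc_of_le hε.2.le, uIcc_of_le zero_le_one]
        exact Icc_subset_Icc_left hε.1.le
      · rw [uIcc_of_le hε.2.le]
        exact H.continuousOn_greenTail.mono hs
    refine Measure.eqOn_Ioo_of_ae_eq (μ := volume) (f := p) (g := fun _ => (0 : ℝ)) ?_
      (hp_cont.mono fun x hx => ⟨hε.1.le.trans hx.1.le, hx.2.le⟩) continuousOn_const
    refine (ae_restrict_iff' measurableSet_Ioo).2 ?_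
    filter_upwards [hdp, hV.ae_hasDerivAt_integral] with x hx hx2 hxm
    have hx01 : x ∈ Ioo (0 : ℝ) 1 := ⟨hε.1.trans hxm.1, hxm.2⟩
    rw [uIcc_of_le hε.2.le] at hx2
    have d1 := hx (Ioo_subset_Icc_self hx01)
    have d2 := hx2 (Ioo_subset_Icc_self hxm) 1 (right_mem_Icc.2 hε.2.le)
    have d3 := H.hasDerivAt_greenTail (Ioo_subset_Ioc_self hx01)
    have d4 := (d3.mul d1).sub d2
    have d5 : HasDerivAt (fun _ : ℝ => (0 : ℝ)) 0 x := hasDerivAt_const _ _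
    have := d4.unique (d5.congr_of_eventuallyEq ?_)
    · have hne := (H.pos x (Ioo_subset_Ioc_self hx01)).ne'
      have h3 : (h x ^ 2)⁻¹ * p x = 0 := by linarith
      exact (mul_eq_zero.1 h3).resolve_left (by positivity)
    · filter_upwards [isOpen_Ioo.mem_nhds hx01] with r hr
      have hr' := Ioo_subset_Ioc_self hr
      have h4 := hzero r hr'
      rw [H.inner_greenVec (Ioc_subset_Icc_self hr'), H.integral_greenKer_mul hr' hfi] at h4
      have h5 := (mul_eq_zero.1 h4).resolve_left (H.pos r hr').ne'
      simp only [Pi.sub_apply, Pi.mul_apply]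
      rw [intervalIntegral.integral_symm r 1]
      linarith
  have hp00 : ∀ x ∈ Ioo (0 : ℝ) 1, p x = 0 := fun x hx =>
    hp0 (x / 2) ⟨by linarith [hx.1], by linarith [hx.1, hx.2]⟩ x ⟨by linarith [hx.1], hx.2⟩
  refine Lp.eq_zero_iff_ae_eq_zero.2 ?_
  change ∀ᵐ x ∂(volume.restrict (Ioc 0 1)), f x = 0
  rw [← Measure.restrict_congr_set Ioo_ae_eq_Ioc, ae_restrict_iff' measurableSet_Ioo]
  filter_upwards [hdp] with x hx hxm
  have d5 : HasDerivAt (fun _ : ℝ => (0 : ℝ)) 0 x := hasDerivAt_const _ _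
  have := (hx (Ioo_subset_Icc_self hxm)).unique (d5.congr_of_eventuallyEq ?_)
  · exact (mul_eq_zero.1 this).resolve_left (H.pos x (Ioo_subset_Ioc_self hxm)).ne'
  · filter_upwards [isOpen_Ioo.mem_nhds hxm] with r hr using hp00 r hr

end IsGroundState

/-- The solution regular at `0` of `d/dx (x^{2ν+1} dE/dx) = a x^{2ν+1} E`. -/
noncomputable def besselProfile (ν a x : ℝ) : ℝ := besselSeries ν (a * x ^ 2 / 4)

/-- The momentum `x^{2ν+1} dE/dx` of `E = besselProfile ν a`. -/
noncomputable def besselMomentum (ν a x : ℝ) : ℝ :=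
  a / 2 * x ^ (2 * ν + 2) * besselSeries (ν + 1) (a * x ^ 2 / 4)

/-- The solution `x^{ν+1/2} besselProfile ν κ x` of `h'' = (κ + (ν²-1/4)x⁻²) h`. -/
noncomputable def besselGround (ν κ x : ℝ) : ℝ := x ^ (ν + 1 / 2) * besselProfile ν κ x

section

variable {ν : ℝ}

theorem hasDerivAt_quadratic (a x : ℝ) : HasDerivAt (fun x : ℝ => a * x ^ 2 / 4) (a * x / 2) x :=
  (((hasDerivAt_pow 2 x).const_mul a).div_const 4).congr_deriv (by norm_num; ring)

theorem hasDerivAt_besselProfile (hν : -1 < ν) (a x : ℝ) :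
    HasDerivAt (besselProfile ν a) (besselSeries (ν + 1) (a * x ^ 2 / 4) * (a * x / 2)) x :=
  (hasDerivAt_besselSeries hν (a * x ^ 2 / 4)).comp x (hasDerivAt_quadratic a x)

theorem continuous_besselProfile (hν : -1 < ν) (a : ℝ) : Continuous (besselProfile ν a) :=
  (continuous_besselSeries hν).comp (by fun_prop)

theorem besselProfile_pos (hν : -1 < ν) {κ : ℝ} (hκ : 0 ≤ κ) (x : ℝ) : 0 < besselProfile ν κ x :=
  besselSeries_pos hν (by positivity)

theorem besselProfile_zero_pos (hν : -1 < ν) (a : ℝ) : 0 < besselProfile ν a 0 := by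
  rw [besselProfile]
  simp only [ne_eq, OfNat.ofNat_ne_zero, not_false_eq_true, zero_pow, mul_zero, zero_div]
  exact besselSeries_pos hν le_rfl

theorem hasDerivAt_besselMomentum (hν : -1 < ν) (a : ℝ) {x : ℝ} (hx : 0 < x) :
    HasDerivAt (besselMomentum ν a) (a * (x ^ (2 * ν + 1) * besselProfile ν a x)) x := by
  have h1 := ((Real.hasDerivAt_rpow_const (p := 2 * ν + 2) (Or.inl hx.ne')).const_mul (a / 2)).mul
    ((hasDerivAt_besselSeries (by linarith : -1 < ν + 1) (a * x ^ 2 / 4)).comp x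
      (hasDerivAt_quadratic a x))
  refine h1.congr_deriv ?_
  rw [besselProfile, ← besselSeries_ode hν, show 2 * ν + 2 = (2 * ν + 1) + 1 by ring,
    Real.rpow_add_one hx.ne', add_sub_cancel_right]
  simp only [Function.comp]
  ring

theorem continuous_besselMomentum (hν : -1 < ν) (a : ℝ) : Continuous (besselMomentum ν a) :=
  (continuous_const.mul (Real.continuous_rpow_const (by linarith))).mul
    ((continuous_besselSeries (by linarith)).comp (by fun_prop))

theorem besselMomentum_zero (hν : -1 < ν) (a : ℝ) : besselMomentum ν a 0 = 0 := by
  rw [besselMomentum, Real.zero_rpow (by linarith)]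
  simp

theorem besselMomentum_eq (a : ℝ) {x : ℝ} (hx : 0 < x) :
    besselMomentum ν a x =
      x ^ (2 * ν + 1) * (besselSeries (ν + 1) (a * x ^ 2 / 4) * (a * x / 2)) := by
  rw [besselMomentum, show 2 * ν + 2 = (2 * ν + 1) + 1 by ring, Real.rpow_add_one hx.ne']
  ring

theorem rpow_half_sq {x : ℝ} (hx : 0 ≤ x) : (x ^ (ν + 1 / 2)) ^ 2 = x ^ (2 * ν + 1) := by
  rw [← Real.rpow_natCast, ← Real.rpow_mul hx]
  congr 1
  push_cast
  ring

theorem isGroundState_besselGround (hν : -(1 / 2) < ν) {κ : ℝ} (hκ : 0 ≤ κ) :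
    IsGroundState (besselGround ν κ) where
  cont := (Real.continuous_rpow_const (by linarith)).mul
    (continuous_besselProfile (by linarith) κ)
  mono := by
    intro x hx y hy hxy
    have hE : besselProfile ν κ x ≤ besselProfile ν κ y :=
      besselSeries_monotoneOn (by linarith) (mem_Ici.2 (by positivity))
        (mem_Ici.2 (by positivity)) (by gcongr; exact hx.1)
    exact mul_le_mul (Real.rpow_le_rpow hx.1 hxy (by linarith)) hE
      (besselProfile_pos (by linarith) hκ x).le (Real.rpow_nonneg hy.1 _)
  pos x hx := mul_pos (Real.rpow_pos_of_pos hx.1 _) (besselProfile_pos (by linarith) hκ x)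
  zero := by rw [besselGround, Real.zero_rpow (by linarith), zero_mul]

theorem isRegularSolution_besselProfile (hν : -(1 / 2) < ν) {κ : ℝ} (hκ : 0 ≤ κ) (a : ℝ) :
    IsRegularSolution (besselGround ν κ) (a - κ)
      (fun x => besselProfile ν a x / besselProfile ν κ x) where
  cont := (continuous_besselProfile (by linarith) a).div (continuous_besselProfile (by linarith) κ)
    fun x => (besselProfile_pos (by linarith) hκ x).ne'
  hasDerivAt x hx := by
    have hν1 : -1 < ν := by linarith
    have hE (t : ℝ) := (besselProfile_pos hν1 hκ t).ne'
    have hW : ∫ t in (0 : ℝ)..x,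
        (a - κ) * (t ^ (2 * ν + 1) * (besselProfile ν a t * besselProfile ν κ t)) =
        (besselMomentum ν a x * besselProfile ν κ x - besselProfile ν a x * besselMomentum ν κ x)
          - (besselMomentum ν a 0 * besselProfile ν κ 0
              - besselProfile ν a 0 * besselMomentum ν κ 0) := by
      refine intervalIntegral.integral_eq_sub_of_hasDerivAt_of_le hx.1.le
        (f := fun x => besselMomentum ν a x * besselProfile ν κ x -
          besselProfile ν a x * besselMomentum ν κ x) ?_ (fun t ht => ?_) ?_
      · exact (((continuous_besselMomentum hν1 a).mul (continuous_besselProfile hν1 κ)).sub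
          ((continuous_besselProfile hν1 a).mul (continuous_besselMomentum hν1 κ))).continuousOn
      · have := ((hasDerivAt_besselMomentum hν1 a ht.1).mul (hasDerivAt_besselProfile hν1 κ t)).sub
          ((hasDerivAt_besselProfile hν1 a t).mul (hasDerivAt_besselMomentum hν1 κ ht.1))
        refine this.congr_deriv ?_
        rw [besselMomentum_eq a ht.1, besselMomentum_eq κ ht.1]
        ring
      · exact (continuous_const.mul ((Real.continuous_rpow_const (by linarith)).mul
          ((continuous_besselProfile hν1 a).mul
            (continuous_besselProfile hν1 κ)))).intervalIntegrable _ _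
    have hP : (a - κ) * (∫ t in (0 : ℝ)..x, besselGround ν κ t ^ 2 *
        (besselProfile ν a t / besselProfile ν κ t)) =
        besselMomentum ν a x * besselProfile ν κ x -
          besselProfile ν a x * besselMomentum ν κ x := by
      rw [besselMomentum_zero hν1, besselMomentum_zero hν1] at hW
      rw [← intervalIntegral.integral_const_mul]
      refine Eq.trans (intervalIntegral.integral_congr fun t ht => ?_) (hW.trans (by ring))
      rw [uIcc_of_le hx.1.le] at ht
      simp only [besselGround, mul_pow, rpow_half_sq ht.1]
      have := hE t
      field_simp
    rw [hP]
    refine ((hasDerivAt_besselProfile hν1 a x).div (hasDerivAt_besselProfile hν1 κ x)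
      (hE x)).congr_deriv ?_
    rw [besselMomentum_eq a hx.1, besselMomentum_eq κ hx.1, besselGround, mul_pow,
      rpow_half_sq hx.1.le]
    have h1 := hE x
    have h2 := (Real.rpow_pos_of_pos hx.1 (2 * ν + 1)).ne'
    generalize x ^ (2 * ν + 1) = R at h2 ⊢
    field_simp

/-- Lommel's integral at a zero. -/
theorem integral_besselProfile_sq (hν : -(1 / 2) < ν) {a : ℝ} (ha : besselProfile ν a 1 = 0) :
    ∫ x in (0 : ℝ)..1, x ^ (2 * ν + 1) * besselProfile ν a x ^ 2 =
      -(a / 8) * besselSeries (ν + 1) (a / 4) ^ 2 := by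
  have hν1 : -1 < ν := by linarith
  set S : ℝ → ℝ := fun x => besselSeries (ν + 1) (a * x ^ 2 / 4) with hS
  have hS_cont : Continuous S := (continuous_besselSeries (by linarith)).comp (by fun_prop)
  have hS' (x : ℝ) :
      HasDerivAt S (besselSeries (ν + 1 + 1) (a * x ^ 2 / 4) * (a * x / 2)) x :=
    hasDerivAt_besselProfile (by linarith) a x
  have hE_cont := continuous_besselProfile hν1 a
  have hr_cont : Continuous fun x : ℝ => x ^ (2 * ν + 2) :=
    Real.continuous_rpow_const (by linarith)
  rw [intervalIntegral.integral_eq_sub_of_hasDerivAt_of_le zero_le_one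
    (f := fun x => x ^ (2 * ν + 2) * (besselProfile ν a x ^ 2 / 2 -
      ν / 2 * (besselProfile ν a x * S x) - a * x ^ 2 / 4 * S x ^ 2 / 2)) ?_ ?_ ?_]
  · rw [Real.zero_rpow (by linarith), Real.one_rpow, ha]
    simp only [hS]
    norm_num
    ring
  · refine (hr_cont.mul ?_).continuousOn
    fun_prop
  · intro x hx
    have hd := (Real.hasDerivAt_rpow_const (x := x) (p := 2 * ν + 2) (Or.inl hx.1.ne')).mul
      (((((hasDerivAt_besselProfile hν1 a x).pow 2).div_const 2).sub
        (((hasDerivAt_besselProfile hν1 a x).mul (hS' x)).const_mul (ν / 2))).sub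
        (((hasDerivAt_quadratic a x).mul ((hS' x).pow 2)).div_const 2))
    refine hd.congr_deriv ?_
    have hode := besselSeries_ode hν1 (a * x ^ 2 / 4)
    rw [show 2 * ν + 2 = (2 * ν + 1) + 1 by ring, Real.rpow_add_one hx.1.ne', add_sub_cancel_right]
    simp only [Pi.mul_apply, Pi.pow_apply, Pi.sub_apply, hS, besselProfile]
    set F2 := besselSeries (ν + 1 + 1) (a * x ^ 2 / 4)
    set F1 := besselSeries (ν + 1) (a * x ^ 2 / 4)
    set R := x ^ (2 * ν + 1)
    rw [← hode]
    norm_num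
    ring
  · exact ((Real.continuous_rpow_const (by linarith)).mul (hE_cont.pow 2)).intervalIntegrable _ _

end

/-- The normalising constant of `fbEigen`. -/
noncomputable def fbEigenConst (ν l : ℝ) : ℝ := √8 / (l * |besselSeries (ν + 1) (-l ^ 2 / 4)|)

/-- The `L²(dx)`-normalised Fourier–Bessel eigenfunction with frequency `l`. -/
noncomputable def fbEigen (ν l x : ℝ) : ℝ :=
  fbEigenConst ν l * (x ^ (ν + 1 / 2) * besselProfile ν (-l ^ 2) x)

section

variable {ν : ℝ}

theorem besselJ_eq_besselProfile {l x : ℝ} (hl : 0 < l) (hx : 0 < x) :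
    besselJ ν (l * x) = (l * x / 2) ^ ν * besselProfile ν (-l ^ 2) x := by
  rw [besselJ_eq ν (mul_pos hl hx), besselProfile]
  congr 2
  ring

theorem besselProfile_one_eq_zero {l : ℝ} (hl : 0 < l) (hJ : besselJ ν l = 0) :
    besselProfile ν (-l ^ 2) 1 = 0 := by
  have h := besselJ_eq_besselProfile (ν := ν) hl one_pos
  rw [mul_one, hJ] at h
  exact (mul_eq_zero.1 h.symm).resolve_left (Real.rpow_pos_of_pos (by positivity) _).ne'

theorem integral_besselProfile_sq_pos (hν : -(1 / 2) < ν) (a : ℝ) :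
    0 < ∫ x in (0 : ℝ)..1, x ^ (2 * ν + 1) * besselProfile ν a x ^ 2 := by
  have hE := continuous_besselProfile (by linarith : -1 < ν) a
  refine intervalIntegral.integral_pos zero_lt_one
    ((Real.continuous_rpow_const (by linarith)).mul (hE.pow 2)).continuousOn
    (fun x hx => mul_nonneg (Real.rpow_nonneg hx.1.le _) (sq_nonneg _)) ?_
  have h1 : ∀ᶠ x in 𝓝[>] (0 : ℝ), 0 < besselProfile ν a x :=
    nhdsWithin_le_nhds (hE.continuousAt.eventually
      (lt_mem_nhds (besselProfile_zero_pos (by linarith) a)))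
  obtain ⟨x, hx, hx'⟩ := (h1.and (Ioc_mem_nhdsGT zero_lt_one)).exists
  exact ⟨x, Ioc_subset_Icc_self hx', mul_pos (Real.rpow_pos_of_pos hx'.1 _) (pow_pos hx 2)⟩

theorem besselSeries_succ_ne_zero (hν : -(1 / 2) < ν) {l : ℝ}
    (h0 : besselProfile ν (-l ^ 2) 1 = 0) : besselSeries (ν + 1) (-l ^ 2 / 4) ≠ 0 := by
  intro h
  have h1 := integral_besselProfile_sq_pos hν (-l ^ 2)
  rw [integral_besselProfile_sq hν h0, h] at h1
  simp at h1

theorem fbEigenConst_pos (hν : -(1 / 2) < ν) {l : ℝ} (hl : 0 < l)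
    (h0 : besselProfile ν (-l ^ 2) 1 = 0) : 0 < fbEigenConst ν l :=
  div_pos (by positivity) (mul_pos hl (abs_pos.2 (besselSeries_succ_ne_zero hν h0)))

theorem continuous_fbEigen (hν : -(1 / 2) < ν) (l : ℝ) : Continuous (fbEigen ν l) :=
  continuous_const.mul ((Real.continuous_rpow_const (by linarith)).mul
    (continuous_besselProfile (by linarith) _))

theorem integral_fbEigen_sq (hν : -(1 / 2) < ν) {l : ℝ} (hl : 0 < l)
    (h0 : besselProfile ν (-l ^ 2) 1 = 0) :
    ∫ x in Ioc (0 : ℝ) 1, fbEigen ν l x * fbEigen ν l x = 1 := by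
  have h1 : ∀ x ∈ uIcc (0 : ℝ) 1, fbEigen ν l x * fbEigen ν l x =
      fbEigenConst ν l ^ 2 * (x ^ (2 * ν + 1) * besselProfile ν (-l ^ 2) x ^ 2) := by
    intro x hx
    rw [uIcc_of_le zero_le_one] at hx
    rw [fbEigen, ← rpow_half_sq hx.1]
    ring
  rw [← intervalIntegral.integral_of_le zero_le_one, intervalIntegral.integral_congr h1,
    intervalIntegral.integral_const_mul, integral_besselProfile_sq hν h0, fbEigenConst, div_pow,
    mul_pow, sq_abs, Real.sq_sqrt (by norm_num)]
  have h2 := besselSeries_succ_ne_zero hν h0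
  generalize besselSeries (ν + 1) (-l ^ 2 / 4) = F at *
  field_simp

theorem phiFB_eq_fbEigen {Λ : ℕ → ℝ} {n : ℕ} (hl : 0 < Λ n) {x : ℝ} (hx : 0 < x) :
    phiFB ν Λ n x = fbEigen ν (Λ n) x * x ^ (-(ν + 1 / 2)) / √(Λ n) := by
  have hx' : x ^ (ν + 1 / 2) * x ^ (-(ν + 1 / 2)) = 1 := by
    rw [← Real.rpow_add hx, add_neg_cancel, Real.rpow_zero]
  have hJ : besselJ (ν + 1) (Λ n) =
      (Λ n / 2) ^ ν * (Λ n / 2) * besselSeries (ν + 1) (-Λ n ^ 2 / 4) := by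
    rw [besselJ_eq (ν + 1) hl, Real.rpow_add_one (by positivity)]
    congr 2
    ring
  have hr : (Λ n * x / 2) ^ ν = (Λ n / 2) ^ ν * x ^ ν := by
    rw [← Real.mul_rpow (by positivity) hx.le]
    congr 1
    ring
  have hxν : x ^ ν * x ^ (-ν) = 1 := by
    rw [← Real.rpow_add hx, add_neg_cancel, Real.rpow_zero]
  have h8 : √8 = 2 * √2 := by
    rw [show (8 : ℝ) = 2 ^ 2 * 2 by norm_num, Real.sqrt_mul (by norm_num),
      Real.sqrt_sq (by norm_num)]
  have hs := Real.mul_self_sqrt hl.le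
  have hsp := Real.sqrt_pos.2 hl
  have hp : 0 < (Λ n / 2) ^ ν := Real.rpow_pos_of_pos (by positivity) _
  rw [phiFB, besselJ_eq_besselProfile hl hx, hJ, fbEigen, fbEigenConst, h8, hr]
  rw [abs_mul, abs_mul, abs_mul, abs_of_pos hl, abs_of_pos hp, abs_of_pos (half_pos hl)]
  generalize x ^ ν = X at *
  generalize x ^ (-ν) = Y at *
  generalize x ^ (ν + 1 / 2) = X' at *
  generalize x ^ (-(ν + 1 / 2)) = Y' at *
  generalize (Λ n / 2) ^ ν = R at *
  generalize |besselSeries (ν + 1) (-Λ n ^ 2 / 4)| = F at *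
  generalize besselProfile ν (-Λ n ^ 2) x = E at *
  generalize √(Λ n) = s at *
  rw [← hs]
  rcases eq_or_ne F 0 with hF | hF
  · simp [hF]
  · calc √2 / (s * s * (R * (s * s / 2) * F)) * s * (R * X * E) * Y
        = √2 / (s * s * (R * (s * s / 2) * F)) * s * (R * E) * (X * Y) := by ring
      _ = 2 * √2 / (s * s * F) * E / s * (X' * Y') := by
        rw [hxν, hx']
        field_simp
      _ = _ := by ring

theorem memLp_of_continuous {g : ℝ → ℝ} (hg : Continuous g) : MemLp g 2 unitMeas := by
  obtain ⟨C, hC⟩ := isCompact_Icc.exists_bound_of_continuousOn (s := Icc (0 : ℝ) 1)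
    hg.continuousOn
  exact memLp_two_of_abs_le hg.aestronglyMeasurable fun x hx => hC x (Ioc_subset_Icc_self hx)

/-- `fbEigen` as an element of `L²`. -/
noncomputable def fbVec (hν : -(1 / 2) < ν) (l : ℝ) : L2Unit :=
  (memLp_of_continuous (continuous_fbEigen hν l)).toLp _

theorem coeFn_fbVec (hν : -(1 / 2) < ν) (l : ℝ) : fbVec hν l =ᵐ[unitMeas] fbEigen ν l :=
  MemLp.coeFn_toLp _

theorem norm_fbVec (hν : -(1 / 2) < ν) {l : ℝ} (hl : 0 < l)
    (h0 : besselProfile ν (-l ^ 2) 1 = 0) : ‖fbVec hν l‖ = 1 := by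
  have h1 : inner ℝ (fbVec hν l) (fbVec hν l) = (1 : ℝ) := by
    rw [inner_L2Unit]
    refine (integral_congr_ae ?_).trans (integral_fbEigen_sq hν hl h0)
    filter_upwards [coeFn_fbVec hν l] with x hx
    rw [hx]
  rw [real_inner_self_eq_norm_sq (fbVec hν l)] at h1
  exact (pow_eq_one_iff_of_nonneg (norm_nonneg _) two_ne_zero).1 h1

theorem inner_greenVec_fbVec (hν : -(1 / 2) < ν) {κ : ℝ} (hκ : 0 ≤ κ) {l : ℝ} (hl : 0 < l)
    (h0 : besselProfile ν (-l ^ 2) 1 = 0) {x : ℝ} (hx : x ∈ Ioc (0 : ℝ) 1) :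
    inner ℝ (greenVec (besselGround ν κ) x) (fbVec hν l) = (l ^ 2 + κ)⁻¹ * fbEigen ν l x := by
  have H := isGroundState_besselGround hν hκ
  have hE (t : ℝ) := (besselProfile_pos (by linarith : -1 < ν) hκ t).ne'
  have hprod (y : ℝ) : fbEigen ν l y = fbEigenConst ν l * (besselGround ν κ y *
      (besselProfile ν (-l ^ 2) y / besselProfile ν κ y)) := by
    rw [fbEigen, besselGround]
    have := hE y
    field_simp
  have key := H.mul_integral_greenKer_regularSolution
    (isRegularSolution_besselProfile hν hκ (-l ^ 2)) hx
  simp only [h0, zero_div, zero_sub] at key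
  have h1 : inner ℝ (greenVec (besselGround ν κ) x) (fbVec hν l) = fbEigenConst ν l *
      ∫ y in Ioc (0 : ℝ) 1, greenKer (besselGround ν κ) x y * (besselGround ν κ y *
        (besselProfile ν (-l ^ 2) y / besselProfile ν κ y)) := by
    rw [H.inner_greenVec (Ioc_subset_Icc_self hx), ← integral_const_mul]
    refine integral_congr_ae ?_
    filter_upwards [coeFn_fbVec hν l] with y hy
    rw [hy, hprod]
    ring
  rw [h1, hprod]
  generalize (∫ y in Ioc (0 : ℝ) 1, greenKer (besselGround ν κ) x y * (besselGround ν κ y *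
    (besselProfile ν (-l ^ 2) y / besselProfile ν κ y))) = I at *
  have h2 : l ^ 2 + κ ≠ 0 := by positivity
  field_simp
  linear_combination -fbEigenConst ν l * key

theorem greenOp_fbVec (hν : -(1 / 2) < ν) {κ : ℝ} (hκ : 0 ≤ κ) {l : ℝ} (hl : 0 < l)
    (h0 : besselProfile ν (-l ^ 2) 1 = 0) :
    (isGroundState_besselGround hν hκ).greenOp (fbVec hν l) = (l ^ 2 + κ)⁻¹ • fbVec hν l := by
  refine Lp.ext ?_
  filter_upwards [(isGroundState_besselGround hν hκ).coeFn_greenOp (fbVec hν l),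
    Lp.coeFn_smul (l ^ 2 + κ)⁻¹ (fbVec hν l), coeFn_fbVec hν l,
    ae_restrict_mem measurableSet_Ioc] with x h1 h2 h3 hx
  rw [h1, h2, Pi.smul_apply, h3, inner_greenVec_fbVec hν hκ hl h0 hx, smul_eq_mul]

theorem inner_fbVec_eq_zero (hν : -(1 / 2) < ν) {l m : ℝ} (hl : 0 < l) (hm : 0 < m) (hlm : l ≠ m)
    (h0 : besselProfile ν (-l ^ 2) 1 = 0) (h0' : besselProfile ν (-m ^ 2) 1 = 0) :
    inner ℝ (fbVec hν l) (fbVec hν m) = (0 : ℝ) := by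
  have h := (isGroundState_besselGround hν le_rfl).isSymmetric_greenOp (fbVec hν l) (fbVec hν m)
  simp only [ContinuousLinearMap.coe_coe] at h
  rw [greenOp_fbVec hν le_rfl hl h0, greenOp_fbVec hν le_rfl hm h0', real_inner_smul_left,
    real_inner_smul_right] at h
  by_contra hne
  have h1 := mul_right_cancel₀ hne h
  rw [inv_inj, add_zero, add_zero, pow_left_inj₀ hl.le hm.le two_ne_zero] at h1
  exact hlm h1

end

section

variable {ν : ℝ} {Λ : ℕ → ℝ}

theorem IsPositiveZerosOfBesselJ.profile (hΛ : IsPositiveZerosOfBesselJ ν Λ) (n : ℕ) :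
    besselProfile ν (-Λ n ^ 2) 1 = 0 :=
  besselProfile_one_eq_zero (hΛ.2.1 n) (hΛ.2.2.1 n)

theorem orthonormal_fbVec (hν : -(1 / 2) < ν) (hΛ : IsPositiveZerosOfBesselJ ν Λ) :
    Orthonormal ℝ fun n => fbVec hν (Λ n) :=
  ⟨fun n => norm_fbVec hν (hΛ.2.1 n) (hΛ.profile n), fun n m hnm =>
    inner_fbVec_eq_zero hν (hΛ.2.1 n) (hΛ.2.1 m) (hΛ.1.injective.ne hnm) (hΛ.profile n)
      (hΛ.profile m)⟩

theorem eigenspace_le_span_fbVec (hν : -(1 / 2) < ν) (hΛ : IsPositiveZerosOfBesselJ ν Λ)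
    (θ : ℝ) :
    Module.End.eigenspace
      ((isGroundState_besselGround hν le_rfl).greenOp : L2Unit →ₗ[ℝ] L2Unit) θ ≤
      Submodule.span ℝ (range fun n => fbVec hν (Λ n)) := by
  intro f hf
  have hν1 : -1 < ν := by linarith
  have H := isGroundState_besselGround hν le_rfl
  have hf' : (isGroundState_besselGround hν le_rfl).greenOp f = θ • f :=
    Module.End.mem_eigenspace_iff.1 hf
  rcases eq_or_ne θ 0 with rfl | hθ
  · rw [zero_smul] at hf'
    rw [H.greenOp_injective hf']
    exact Submodule.zero_mem _
  have hreg := isRegularSolution_besselProfile hν le_rfl (-θ⁻¹)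
  rw [sub_zero] at hreg
  have hE (t : ℝ) := besselProfile_pos hν1 le_rfl t
  rcases H.eigenvector_greenOp hθ hf' hreg
    (div_pos (besselProfile_zero_pos hν1 _) (hE 0)).ne' with h | ⟨h1, b, hb⟩
  · rw [h]
    exact Submodule.zero_mem _
  · have h1' : besselProfile ν (-θ⁻¹) 1 = 0 := (div_eq_zero_iff.1 h1).resolve_right (hE 1).ne'
    have hneg : -θ⁻¹ < 0 := by
      by_contra hcon
      exact (besselProfile_pos hν1 (not_lt.1 hcon) 1).ne' h1'
    have hl : 0 < √(θ⁻¹) := Real.sqrt_pos.2 (by linarith)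
    have hl2 : -√(θ⁻¹) ^ 2 = -θ⁻¹ := by rw [Real.sq_sqrt (by linarith)]
    have hJ : besselJ ν √(θ⁻¹) = 0 := by
      have := besselJ_eq_besselProfile (ν := ν) hl one_pos
      rw [mul_one, hl2, h1', mul_zero] at this
      exact this
    obtain ⟨n, hn⟩ := hΛ.2.2.2 _ hl hJ
    have hC := (fbEigenConst_pos hν (hΛ.2.1 n) (hΛ.profile n)).ne'
    have : f = (b / fbEigenConst ν (Λ n)) • fbVec hν (Λ n) := by
      refine Lp.ext ?_
      filter_upwards [hb, Lp.coeFn_smul (b / fbEigenConst ν (Λ n)) (fbVec hν (Λ n)),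
        coeFn_fbVec hν (Λ n)] with x h2 h3 h4
      have := (hE x).ne'
      rw [h2, h3, Pi.smul_apply, h4, fbEigen, besselGround, smul_eq_mul,
        show -Λ n ^ 2 = -θ⁻¹ by rw [hn, hl2]]
      generalize -θ⁻¹ = a at *
      field_simp
    rw [this]
    exact Submodule.smul_mem _ _ (Submodule.subset_span (mem_range_self n))

theorem span_fbVec_orthogonal (hν : -(1 / 2) < ν) (hΛ : IsPositiveZerosOfBesselJ ν Λ) :
    (Submodule.span ℝ (range fun n => fbVec hν (Λ n)))ᗮ = ⊥ := by
  have H := isGroundState_besselGround hν le_rfl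
  have := ContinuousLinearMap.orthogonalComplement_iSup_eigenspaces_eq_bot
    H.isCompactOperator_greenOp H.isSymmetric_greenOp
  rw [eq_bot_iff, ← this]
  exact Submodule.orthogonal_le (iSup_le fun θ => eigenspace_le_span_fbVec hν hΛ θ)

/-- Parseval's identity for the Fourier–Bessel system. -/
theorem hasSum_inner_fbVec (hν : -(1 / 2) < ν) (hΛ : IsPositiveZerosOfBesselJ ν Λ)
    (f g : L2Unit) :
    HasSum (fun n => inner ℝ f (fbVec hν (Λ n)) * inner ℝ (fbVec hν (Λ n)) g) (inner ℝ f g) := by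
  have := (HilbertBasis.mkOfOrthogonalEqBot (orthonormal_fbVec hν hΛ)
    (span_fbVec_orthogonal hν hΛ)).hasSum_inner_mul_inner f g
  simpa only [HilbertBasis.coe_mkOfOrthogonalEqBot] using this

theorem inner_fbVec_greenOp_pow (hν : -(1 / 2) < ν) {κ : ℝ} (hκ : 0 ≤ κ)
    (hΛ : IsPositiveZerosOfBesselJ ν Λ) (n m : ℕ) (f : L2Unit) :
    inner ℝ (((isGroundState_besselGround hν hκ).greenOp ^ m) f) (fbVec hν (Λ n)) =
      ((Λ n ^ 2 + κ)⁻¹) ^ m * inner ℝ f (fbVec hν (Λ n)) := by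
  induction m with
  | zero => simp
  | succ m ih =>
    rw [pow_succ', mul_apply_eq_comp]
    have := (isGroundState_besselGround hν hκ).isSymmetric_greenOp
      (((isGroundState_besselGround hν hκ).greenOp ^ m) f) (fbVec hν (Λ n))
    simp only [ContinuousLinearMap.coe_coe] at this
    rw [this, greenOp_fbVec hν hκ (hΛ.2.1 n) (hΛ.profile n), real_inner_smul_right, ih]
    ring

theorem IsGroundState.greenOp_pow_nonneg {h : ℝ → ℝ} (H : IsGroundState h) {f : L2Unit}
    (hf : 0 ≤ᵐ[unitMeas] f) (m : ℕ) : 0 ≤ᵐ[unitMeas] (H.greenOp ^ m) f := by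
  induction m with
  | zero => simpa using hf
  | succ m ih =>
    rw [pow_succ', mul_apply_eq_comp]
    exact H.greenOp_nonneg ih

theorem IsGroundState.greenVec_nonneg {h : ℝ → ℝ} (H : IsGroundState h) {x : ℝ}
    (hx : x ∈ Icc (0 : ℝ) 1) : 0 ≤ᵐ[unitMeas] greenVec h x := by
  filter_upwards [H.coeFn_greenVec hx, ae_restrict_mem measurableSet_Ioc] with y hy hy'
  rw [hy]
  exact H.greenKer_nonneg hx (Ioc_subset_Icc_self hy')

/-- The kernels of the powers of the resolvent of order at least two are nonnegative. -/
theorem tsum_resolvent_pow_nonneg (hν : -(1 / 2) < ν) (hΛ : IsPositiveZerosOfBesselJ ν Λ)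
    {κ : ℝ} (hκ : 0 ≤ κ) (m : ℕ) {x y : ℝ} (hx : x ∈ Ioc (0 : ℝ) 1) (hy : y ∈ Ioc (0 : ℝ) 1) :
    0 ≤ ∑' n, ((Λ n ^ 2 + κ)⁻¹) ^ (m + 2) * (fbEigen ν (Λ n) x * fbEigen ν (Λ n) y) := by
  have H := isGroundState_besselGround hν hκ
  have h1 := hasSum_inner_fbVec hν hΛ
    ((H.greenOp ^ m) (greenVec (besselGround ν κ) x)) (greenVec (besselGround ν κ) y)
  have h2 : ∀ n, inner ℝ ((H.greenOp ^ m) (greenVec (besselGround ν κ) x)) (fbVec hν (Λ n)) *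
      inner ℝ (fbVec hν (Λ n)) (greenVec (besselGround ν κ) y) =
      ((Λ n ^ 2 + κ)⁻¹) ^ (m + 2) * (fbEigen ν (Λ n) x * fbEigen ν (Λ n) y) := by
    intro n
    rw [inner_fbVec_greenOp_pow hν hκ hΛ, real_inner_comm (greenVec (besselGround ν κ) y),
      inner_greenVec_fbVec hν hκ (hΛ.2.1 n) (hΛ.profile n) hx,
      inner_greenVec_fbVec hν hκ (hΛ.2.1 n) (hΛ.profile n) hy]
    ring
  simp only [h2] at h1
  rw [h1.tsum_eq, inner_L2Unit]
  refine integral_nonneg_of_ae ?_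
  filter_upwards [H.greenOp_pow_nonneg (H.greenVec_nonneg (Ioc_subset_Icc_self hx)) m,
    H.greenVec_nonneg (Ioc_subset_Icc_self hy)] with r h3 h4
  exact mul_nonneg h3 h4

theorem summable_fbEigen_sq (hν : -(1 / 2) < ν) (hΛ : IsPositiveZerosOfBesselJ ν Λ)
    {x : ℝ} (hx : x ∈ Ioc (0 : ℝ) 1) :
    Summable (fun n => fbEigen ν (Λ n) x ^ 2 / Λ n ^ 4) ∧
      ∑' n, fbEigen ν (Λ n) x ^ 2 / Λ n ^ 4 ≤ 1 := by
  have H := isGroundState_besselGround hν le_rfl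
  have h2 : ∀ n, ‖inner ℝ (fbVec hν (Λ n)) (greenVec (besselGround ν 0) x)‖ ^ 2 =
      fbEigen ν (Λ n) x ^ 2 / Λ n ^ 4 := by
    intro n
    rw [Real.norm_eq_abs, sq_abs, real_inner_comm,
      inner_greenVec_fbVec hν le_rfl (hΛ.2.1 n) (hΛ.profile n) hx]
    have := (hΛ.2.1 n).ne'
    field_simp
    ring
  have h3 := (orthonormal_fbVec hν hΛ).inner_products_summable (greenVec (besselGround ν 0) x)
  have h4 := (orthonormal_fbVec hν hΛ).tsum_inner_products_le (greenVec (besselGround ν 0) x)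
  simp only [h2] at h3 h4
  refine ⟨h3, h4.trans ?_⟩
  exact pow_le_one₀ (norm_nonneg _) (H.norm_greenVec_le (Ioc_subset_Icc_self hx))

theorem summable_fbEigen_mul (hν : -(1 / 2) < ν) (hΛ : IsPositiveZerosOfBesselJ ν Λ)
    {x y : ℝ} (hx : x ∈ Ioc (0 : ℝ) 1) (hy : y ∈ Ioc (0 : ℝ) 1) :
    Summable fun n => |fbEigen ν (Λ n) x * fbEigen ν (Λ n) y| / Λ n ^ 4 := by
  refine Summable.of_nonneg_of_le (fun n => by have := hΛ.2.1 n; positivity) (fun n => ?_)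
    ((summable_fbEigen_sq hν hΛ hx).1.add (summable_fbEigen_sq hν hΛ hy).1)
  have := hΛ.2.1 n
  rw [← add_div, abs_mul]
  gcongr
  nlinarith [sq_abs (fbEigen ν (Λ n) x), sq_abs (fbEigen ν (Λ n) y),
    sq_nonneg (|fbEigen ν (Λ n) x| - |fbEigen ν (Λ n) y|), sq_nonneg (fbEigen ν (Λ n) x),
    sq_nonneg (fbEigen ν (Λ n) y)]

theorem exp_neg_le_inv_sq {u : ℝ} (hu : 0 < u) : exp (-u) ≤ 2 / u ^ 2 := by
  rw [Real.exp_neg, inv_le_comm₀ (exp_pos _) (by positivity), inv_div]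
  linarith [Real.quadratic_le_exp_of_nonneg hu.le]

theorem exp_neg_mul_sq_le {s l : ℝ} (hs : 0 < s) (hl : 0 < l) :
    exp (-s * l ^ 2) ≤ 2 / s ^ 2 / l ^ 4 := by
  refine (le_of_eq (by ring_nf)).trans
    ((exp_neg_le_inv_sq (u := s * l ^ 2) (by positivity)).trans (le_of_eq ?_))
  field_simp

theorem summable_exp_fbEigen (hν : -(1 / 2) < ν) (hΛ : IsPositiveZerosOfBesselJ ν Λ) {s : ℝ}
    (hs : 0 < s) {x y : ℝ} (hx : x ∈ Ioc (0 : ℝ) 1) (hy : y ∈ Ioc (0 : ℝ) 1) :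
    Summable fun n => exp (-s * Λ n ^ 2) * |fbEigen ν (Λ n) x * fbEigen ν (Λ n) y| := by
  refine Summable.of_nonneg_of_le (fun n => by positivity) (fun n => ?_)
    ((summable_fbEigen_mul hν hΛ hx hy).mul_left (2 / s ^ 2))
  calc exp (-s * Λ n ^ 2) * |fbEigen ν (Λ n) x * fbEigen ν (Λ n) y|
      ≤ 2 / s ^ 2 / Λ n ^ 4 * |fbEigen ν (Λ n) x * fbEigen ν (Λ n) y| := by
        gcongr
        exact exp_neg_mul_sq_le hs (hΛ.2.1 n)
    _ = _ := by ring

theorem tsum_exp_fbEigen_nonneg (hν : -(1 / 2) < ν) (hΛ : IsPositiveZerosOfBesselJ ν Λ) {s : ℝ}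
    (hs : 0 < s) {x y : ℝ} (hx : x ∈ Ioc (0 : ℝ) 1) (hy : y ∈ Ioc (0 : ℝ) 1) :
    0 ≤ ∑' n, exp (-s * Λ n ^ 2) * (fbEigen ν (Λ n) x * fbEigen ν (Λ n) y) := by
  have hlim : Tendsto (fun j : ℕ => ∑' n, ((1 + s * Λ n ^ 2 / ((2 * (j + 1) : ℕ) : ℝ)) ^
      (2 * (j + 1)))⁻¹ * (fbEigen ν (Λ n) x * fbEigen ν (Λ n) y)) atTop
      (𝓝 (∑' n, exp (-s * Λ n ^ 2) * (fbEigen ν (Λ n) x * fbEigen ν (Λ n) y))) := by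
    refine tendsto_tsum_of_dominated_convergence
      ((summable_fbEigen_mul hν hΛ hx hy).mul_left (4 / s ^ 2)) (fun n => ?_)
      (.of_forall fun j n => ?_)
    · refine Tendsto.mul_const _ ?_
      rw [neg_mul, Real.exp_neg]
      have h2 : Tendsto (fun j : ℕ => 2 * (j + 1)) atTop atTop :=
        tendsto_atTop_mono (fun j => by simp only [id]; omega) tendsto_id
      exact ((Real.tendsto_one_add_div_pow_exp (s * Λ n ^ 2)).comp h2).inv₀ (exp_pos _).ne'
    · have hl := hΛ.2.1 n
      set u := s * Λ n ^ 2 with hu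
      have hu0 : 0 < u := by positivity
      have h1 : (u / 2) ^ 2 ≤ (1 + u / ((2 * (j + 1) : ℕ) : ℝ)) ^ (2 * (j + 1)) := by
        rw [mul_comm 2 (j + 1), pow_mul]
        have := one_add_mul_le_pow (a := u / (((j + 1) * 2 : ℕ) : ℝ))
          (by have : 0 ≤ u / (((j + 1) * 2 : ℕ) : ℝ) := by positivity
              linarith) (j + 1)
        gcongr
        refine le_trans ?_ this
        have e : ((j + 1 : ℕ) : ℝ) * (u / (((j + 1) * 2 : ℕ) : ℝ)) = u / 2 := by
          push_cast
          field_simp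
        rw [e]
        linarith
      rw [norm_mul, Real.norm_eq_abs, Real.norm_eq_abs, abs_of_nonneg (by positivity)]
      calc _ ≤ ((u / 2) ^ 2)⁻¹ * |fbEigen ν (Λ n) x * fbEigen ν (Λ n) y| := by gcongr
        _ = _ := by
          rw [hu]
          field_simp
          ring
  refine ge_of_tendsto' hlim fun j => ?_
  set N : ℝ := ((2 * (j + 1) : ℕ) : ℝ) with hN
  have hNpos : 0 < N := by positivity
  have h0 := tsum_resolvent_pow_nonneg hν hΛ (κ := N / s) (by positivity) (2 * j) hx hy
  have h1 := mul_nonneg (pow_nonneg (by positivity : 0 ≤ N / s) (2 * j + 2)) h0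
  rw [← tsum_mul_left] at h1
  refine h1.trans (le_of_eq (tsum_congr fun n => ?_))
  rw [← mul_assoc, ← mul_pow, show 2 * (j + 1) = 2 * j + 2 by ring, ← inv_pow]
  congr 2
  have := hΛ.2.1 n
  field_simp
  ring

theorem summable_exp_div_fbEigen (hν : -(1 / 2) < ν) (hΛ : IsPositiveZerosOfBesselJ ν Λ) {s : ℝ}
    (hs : 0 < s) {x y : ℝ} (hx : x ∈ Ioc (0 : ℝ) 1) (hy : y ∈ Ioc (0 : ℝ) 1) :
    Summable fun n => exp (-s * Λ n ^ 2) * |fbEigen ν (Λ n) x * fbEigen ν (Λ n) y| / Λ n := by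
  refine Summable.of_nonneg_of_le (fun n => by have := hΛ.2.1 n; positivity) (fun n => ?_)
    ((summable_exp_fbEigen hν hΛ hs hx hy).div_const (Λ 0))
  have h0 := hΛ.2.1 0
  have h1 := hΛ.1.monotone (Nat.zero_le n)
  gcongr

/-- The square root of the Green operator times the heat semigroup has a nonnegative kernel,
by subordination. -/
theorem tsum_exp_div_fbEigen_nonneg (hν : -(1 / 2) < ν) (hΛ : IsPositiveZerosOfBesselJ ν Λ)
    {s : ℝ} (hs : 0 < s) {x y : ℝ} (hx : x ∈ Ioc (0 : ℝ) 1) (hy : y ∈ Ioc (0 : ℝ) 1) :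
    0 ≤ ∑' n, exp (-s * Λ n ^ 2) * (fbEigen ν (Λ n) x * fbEigen ν (Λ n) y) / Λ n := by
  set F : ℕ → ℝ → ℝ := fun n u =>
    exp (-s * Λ n ^ 2) * (fbEigen ν (Λ n) x * fbEigen ν (Λ n) y) * exp (-Λ n ^ 2 * u ^ 2) with hF
  have hgauss (n : ℕ) : ∫ u in Ioi (0 : ℝ), exp (-Λ n ^ 2 * u ^ 2) = √π / 2 / Λ n := by
    have := hΛ.2.1 n
    rw [integral_gaussian_Ioi, Real.sqrt_div Real.pi_pos.le, Real.sqrt_sq this.le]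
    ring
  have hint : ∀ n, Integrable (F n) (volume.restrict (Ioi 0)) := fun n => by
    have := hΛ.2.1 n
    exact ((integrable_exp_neg_mul_sq (b := Λ n ^ 2) (by positivity)).const_mul _).integrableOn
  have hsum : HasSum (fun n => ∫ u in Ioi (0 : ℝ), F n u) (∫ u in Ioi (0 : ℝ), ∑' n, F n u) := by
    refine hasSum_integral_of_summable_integral_norm hint ?_
    refine ((summable_exp_div_fbEigen hν hΛ hs hx hy).mul_left (√π / 2)).congr fun n => ?_
    simp only [hF, norm_mul, Real.norm_eq_abs, Real.abs_exp]
    rw [integral_const_mul, hgauss, abs_mul]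
    ring
  have hval : ∀ n, ∫ u in Ioi (0 : ℝ), F n u =
      √π / 2 * (exp (-s * Λ n ^ 2) * (fbEigen ν (Λ n) x * fbEigen ν (Λ n) y) / Λ n) := by
    intro n
    simp only [hF]
    rw [integral_const_mul, hgauss]
    ring
  have hnn : 0 ≤ ∫ u in Ioi (0 : ℝ), ∑' n, F n u := by
    refine integral_nonneg fun u => ?_
    refine (tsum_exp_fbEigen_nonneg hν hΛ (by positivity : 0 < s + u ^ 2) hx hy).trans
      (le_of_eq (tsum_congr fun n => ?_))
    simp only [hF]
    rw [show -(s + u ^ 2) * Λ n ^ 2 = -s * Λ n ^ 2 + -Λ n ^ 2 * u ^ 2 by ring, Real.exp_add]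
    ring
  rw [← hsum.tsum_eq] at hnn
  simp only [hval, tsum_mul_left] at hnn
  exact nonneg_of_mul_nonneg_right hnn (by positivity)

end

section

variable {ν : ℝ} {Λ : ℕ → ℝ}

theorem abs_fbEigen_le (hν : -(1 / 2) < ν) (hΛ : IsPositiveZerosOfBesselJ ν Λ) (n : ℕ)
    {x : ℝ} (hx : x ∈ Ioc (0 : ℝ) 1) : |fbEigen ν (Λ n) x| ≤ Λ n ^ 2 := by
  obtain ⟨h1, h2⟩ := summable_fbEigen_sq hν hΛ hx
  have hl := hΛ.2.1 n
  have h3 : fbEigen ν (Λ n) x ^ 2 / Λ n ^ 4 ≤ 1 :=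
    (h1.le_tsum n fun m _ => by have := hΛ.2.1 m; positivity).trans h2
  rw [div_le_one (by positivity)] at h3
  refine abs_le_of_sq_le_sq (h3.trans (le_of_eq (by ring))) (by positivity)

theorem summable_inv_zeros_pow_four (hν : -(1 / 2) < ν) (hΛ : IsPositiveZerosOfBesselJ ν Λ) :
    Summable fun n => (Λ n ^ 4)⁻¹ := by
  refine summable_of_sum_le (c := 1) (fun n => by have := hΛ.2.1 n; positivity) fun F => ?_
  have hint (n : ℕ) : Integrable (fun x => fbEigen ν (Λ n) x * fbEigen ν (Λ n) x / Λ n ^ 4)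
      unitMeas :=
    IsGroundState.integrable_unitMeas (((continuous_fbEigen hν _).mul
      (continuous_fbEigen hν _)).div_const _)
  have h1 : ∑ n ∈ F, (Λ n ^ 4)⁻¹ =
      ∫ x in Ioc (0 : ℝ) 1, ∑ n ∈ F, fbEigen ν (Λ n) x * fbEigen ν (Λ n) x / Λ n ^ 4 := by
    rw [integral_finsetSum _ fun n _ => hint n]
    refine Finset.sum_congr rfl fun n _ => ?_
    rw [integral_div, integral_fbEigen_sq hν (hΛ.2.1 n) (hΛ.profile n), one_div]
  rw [h1]
  calc _ ≤ ∫ _ in Ioc (0 : ℝ) 1, (1 : ℝ) := by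
        refine setIntegral_mono_on (integrable_finsetSum _ fun n _ => hint n) (by simp)
          measurableSet_Ioc fun x hx => ?_
        obtain ⟨h2, h3⟩ := summable_fbEigen_sq hν hΛ hx
        simp only [← sq]
        exact (h2.sum_le_tsum F fun m _ => by have := hΛ.2.1 m; positivity).trans h3
    _ = 1 := by simp

theorem exp_neg_mul_sq_le_pow {s l : ℝ} (hs : 0 < s) (hl : 0 < l) :
    exp (-s * l ^ 2) ≤ 24 / s ^ 4 / l ^ 8 := by
  have h := Real.pow_div_factorial_le_exp (s * l ^ 2) (by positivity) 4
  rw [neg_mul, Real.exp_neg, inv_le_comm₀ (exp_pos _) (by positivity)]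
  refine (le_of_eq ?_).trans h
  norm_num [Nat.factorial]
  field_simp

theorem besselProfile_first_zero_pos (hν : -(1 / 2) < ν) (hΛ : IsPositiveZerosOfBesselJ ν Λ)
    {x : ℝ} (hx : x ∈ Ico (0 : ℝ) 1) : 0 < besselProfile ν (-Λ 0 ^ 2) x := by
  have hν1 : -1 < ν := by linarith
  by_contra hcon
  have hE := continuous_besselProfile hν1 (-Λ 0 ^ 2)
  have h0 := besselProfile_zero_pos hν1 (-Λ 0 ^ 2)
  obtain ⟨r, hr, hr0⟩ := intermediate_value_Icc' hx.1 hE.continuousOn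
    (show (0 : ℝ) ∈ Icc _ _ from ⟨not_lt.1 hcon, h0.le⟩)
  have hrpos : 0 < r := hr.1.lt_of_ne (by rintro rfl; exact h0.ne' hr0)
  have hl := hΛ.2.1 0
  have hJ : besselJ ν (Λ 0 * r) = 0 := by
    rw [besselJ_eq_besselProfile hl hrpos, hr0, mul_zero]
  obtain ⟨n, hn⟩ := hΛ.2.2.2 _ (by positivity) hJ
  have h1 := hΛ.1.monotone (Nat.zero_le n)
  have h2 : Λ 0 * r < Λ 0 := by nlinarith [hr.2, hx.2]
  linarith

theorem fbEigen_first_pos (hν : -(1 / 2) < ν) (hΛ : IsPositiveZerosOfBesselJ ν Λ)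
    {x : ℝ} (hx : x ∈ Ioo (0 : ℝ) 1) : 0 < fbEigen ν (Λ 0) x :=
  mul_pos (fbEigenConst_pos hν (hΛ.2.1 0) (hΛ.profile 0))
    (mul_pos (Real.rpow_pos_of_pos hx.1 _)
      (besselProfile_first_zero_pos hν hΛ ⟨hx.1.le, hx.2⟩))

theorem fbEigen_first_nonneg (hν : -(1 / 2) < ν) (hΛ : IsPositiveZerosOfBesselJ ν Λ)
    {x : ℝ} (hx : x ∈ Ioc (0 : ℝ) 1) : 0 ≤ fbEigen ν (Λ 0) x := by
  rcases hx.2.eq_or_lt with rfl | h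
  · rw [fbEigen, hΛ.profile 0, mul_zero, mul_zero]
  · exact (fbEigen_first_pos hν hΛ ⟨hx.1, h⟩).le

/-- The kernel of the heat semigroup composed with the square root of the Green operator, for the
Fourier–Bessel system in `L²(dx)`. -/
noncomputable def fbKernel (ν : ℝ) (Λ : ℕ → ℝ) (s x y : ℝ) : ℝ :=
  ∑' n, exp (-s * Λ n ^ 2) * (fbEigen ν (Λ n) x * fbEigen ν (Λ n) y) / Λ n

theorem fbHeatKer_eq_fbKernel (hΛ : IsPositiveZerosOfBesselJ ν Λ) (s : ℝ) {x y : ℝ} (hx : 0 < x)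
    (hy : 0 < y) : fbHeatKer ν Λ s x y =
      x ^ (-(ν + 1 / 2)) * y ^ (-(ν + 1 / 2)) * fbKernel ν Λ s x y := by
  rw [fbHeatKer, fbKernel, ← tsum_mul_left]
  refine tsum_congr fun n => ?_
  have hl := hΛ.2.1 n
  rw [phiFB_eq_fbEigen hl hx, phiFB_eq_fbEigen hl hy]
  have hs := Real.mul_self_sqrt hl.le
  have hsp := Real.sqrt_pos.2 hl
  generalize fbEigen ν (Λ n) x = a
  generalize fbEigen ν (Λ n) y = b
  generalize exp (-s * Λ n ^ 2) = e
  generalize √(Λ n) = r at hs hsp ⊢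
  rw [← hs]
  field_simp

theorem norm_fbKernel_term_le (hν : -(1 / 2) < ν) (hΛ : IsPositiveZerosOfBesselJ ν Λ) {s : ℝ}
    (hs : 0 < s) {x y : ℝ} (hx : x ∈ Ioc (0 : ℝ) 1) (hy : y ∈ Ioc (0 : ℝ) 1) (n : ℕ) :
    ‖exp (-s * Λ n ^ 2) * (fbEigen ν (Λ n) x * fbEigen ν (Λ n) y) / Λ n‖ ≤
      24 / s ^ 4 / Λ 0 * (Λ n ^ 4)⁻¹ := by
  have hl := hΛ.2.1 n
  have hl0 := hΛ.2.1 0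
  rw [norm_div, norm_mul, norm_mul, Real.norm_eq_abs, Real.norm_eq_abs, Real.norm_eq_abs,
    Real.norm_eq_abs, Real.abs_exp, abs_of_pos hl]
  calc exp (-s * Λ n ^ 2) * (|fbEigen ν (Λ n) x| * |fbEigen ν (Λ n) y|) / Λ n
      ≤ 24 / s ^ 4 / Λ n ^ 8 * (Λ n ^ 2 * Λ n ^ 2) / Λ 0 := by
        gcongr
        · exact exp_neg_mul_sq_le_pow hs hl
        · exact abs_fbEigen_le hν hΛ n hx
        · exact abs_fbEigen_le hν hΛ n hy
        · exact hΛ.1.monotone (Nat.zero_le n)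
    _ = _ := by field_simp

theorem continuousOn_fbKernel (hν : -(1 / 2) < ν) (hΛ : IsPositiveZerosOfBesselJ ν Λ) {s : ℝ}
    (hs : 0 < s) {y : ℝ} (hy : y ∈ Ioc (0 : ℝ) 1) :
    ContinuousOn (fun x => fbKernel ν Λ s x y) (Ioc 0 1) :=
  continuousOn_tsum
    (fun _ => ((continuous_const.mul ((continuous_fbEigen hν _).mul continuous_const)).div_const
      _).continuousOn)
    ((summable_inv_zeros_pow_four hν hΛ).mul_left (24 / s ^ 4 / Λ 0))
    fun n _ hx => norm_fbKernel_term_le hν hΛ hs hx hy n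

theorem integrable_fbKernel_mul (hν : -(1 / 2) < ν) (hΛ : IsPositiveZerosOfBesselJ ν Λ) {s : ℝ}
    (hs : 0 < s) {y : ℝ} (hy : y ∈ Ioc (0 : ℝ) 1) :
    Integrable (fun x => fbKernel ν Λ s x y * fbEigen ν (Λ 0) x) unitMeas := by
  refine (IsGroundState.integrable_unitMeas (continuous_fbEigen hν (Λ 0))).bdd_mul
    (c := ∑' n, 24 / s ^ 4 / Λ 0 * (Λ n ^ 4)⁻¹)
    ((continuousOn_fbKernel hν hΛ hs hy).aestronglyMeasurable measurableSet_Ioc)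
    ((ae_restrict_iff' measurableSet_Ioc).2 (.of_forall fun x hx => ?_))
  exact tsum_of_norm_bounded ((summable_inv_zeros_pow_four hν hΛ).mul_left _).hasSum
    fun n => norm_fbKernel_term_le hν hΛ hs hx hy n

theorem integral_fbEigen_mul (hν : -(1 / 2) < ν) (hΛ : IsPositiveZerosOfBesselJ ν Λ) (n m : ℕ) :
    ∫ x in Ioc (0 : ℝ) 1, fbEigen ν (Λ n) x * fbEigen ν (Λ m) x = if n = m then 1 else 0 := by
  rw [← orthonormal_iff_ite.1 (orthonormal_fbVec hν hΛ) n m, inner_L2Unit]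
  refine integral_congr_ae ?_
  filter_upwards [coeFn_fbVec hν (Λ n), coeFn_fbVec hν (Λ m)] with x h1 h2
  rw [h1, h2]

theorem integral_fbKernel_mul (hν : -(1 / 2) < ν) (hΛ : IsPositiveZerosOfBesselJ ν Λ) {s : ℝ}
    (hs : 0 < s) {y : ℝ} (hy : y ∈ Ioc (0 : ℝ) 1) :
    ∫ x in Ioc (0 : ℝ) 1, fbKernel ν Λ s x y * fbEigen ν (Λ 0) x =
      exp (-s * Λ 0 ^ 2) * fbEigen ν (Λ 0) y / Λ 0 := by
  set F : ℕ → ℝ → ℝ := fun n x =>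
    exp (-s * Λ n ^ 2) * (fbEigen ν (Λ n) x * fbEigen ν (Λ n) y) / Λ n * fbEigen ν (Λ 0) x with hF
  have hF_cont (n : ℕ) : Continuous (F n) :=
    ((continuous_const.mul ((continuous_fbEigen hν _).mul continuous_const)).div_const _).mul
      (continuous_fbEigen hν _)
  have hsum := hasSum_integral_of_summable_integral_norm (μ := unitMeas) (F := F)
    (fun n => IsGroundState.integrable_unitMeas (hF_cont n)) (by
      refine Summable.of_nonneg_of_le (fun n => integral_nonneg fun x => norm_nonneg _)
        (fun n => ?_) (((summable_inv_zeros_pow_four hν hΛ).mul_left (24 / s ^ 4 / Λ 0)).mul_right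
          (Λ 0 ^ 2))
      calc ∫ x in Ioc (0 : ℝ) 1, ‖F n x‖
          ≤ ∫ _ in Ioc (0 : ℝ) 1, 24 / s ^ 4 / Λ 0 * (Λ n ^ 4)⁻¹ * Λ 0 ^ 2 := by
            refine setIntegral_mono_on
              (IsGroundState.integrable_unitMeas (hF_cont n).norm) (integrable_const _)
              measurableSet_Ioc fun x hx => ?_
            simp only [hF]
            rw [norm_mul]
            gcongr
            · exact (norm_nonneg _).trans (norm_fbKernel_term_le hν hΛ hs hx hy n)
            · exact norm_fbKernel_term_le hν hΛ hs hx hy n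
            · exact abs_fbEigen_le hν hΛ 0 hx
        _ = _ := by simp)
  have hval (n : ℕ) : ∫ x in Ioc (0 : ℝ) 1, F n x =
      if n = 0 then exp (-s * Λ 0 ^ 2) * fbEigen ν (Λ 0) y / Λ 0 else 0 := by
    have h1 (x : ℝ) : F n x = exp (-s * Λ n ^ 2) * fbEigen ν (Λ n) y / Λ n *
        (fbEigen ν (Λ n) x * fbEigen ν (Λ 0) x) := by
      simp only [hF]
      ring
    simp only [h1]
    rw [integral_const_mul, integral_fbEigen_mul hν hΛ]
    split_ifs with h
    · rw [h, mul_one]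
    · rw [mul_zero]
  simp only [hval] at hsum
  have h2 := hsum.unique (hasSum_ite_eq 0 _)
  rw [← h2]
  refine integral_congr_ae (.of_forall fun x => ?_)
  simp only [fbKernel, hF, tsum_mul_right]

theorem fbKernel_nonneg (hν : -(1 / 2) < ν) (hΛ : IsPositiveZerosOfBesselJ ν Λ) {s : ℝ}
    (hs : 0 < s) {x y : ℝ} (hx : x ∈ Ioc (0 : ℝ) 1) (hy : y ∈ Ioc (0 : ℝ) 1) :
    0 ≤ fbKernel ν Λ s x y :=
  tsum_exp_div_fbEigen_nonneg hν hΛ hs hx hy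

theorem fbHeatKer_nonneg (hν : -(1 / 2) < ν) (hΛ : IsPositiveZerosOfBesselJ ν Λ) {s : ℝ}
    (hs : 0 < s) {x y : ℝ} (hx : x ∈ Ioc (0 : ℝ) 1) (hy : y ∈ Ioc (0 : ℝ) 1) :
    0 ≤ fbHeatKer ν Λ s x y := by
  rw [fbHeatKer_eq_fbKernel hΛ s hx.1 hy.1]
  exact mul_nonneg (mul_nonneg (Real.rpow_nonneg hx.1.le _) (Real.rpow_nonneg hy.1.le _))
    (fbKernel_nonneg hν hΛ hs hx hy)

/-- The heat kernel has bounded mass on compact subintervals of `(0,1)`, uniformly in time and in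
the other variable. -/
theorem lintegral_fbHeatKer_le (hν : -(1 / 2) < ν) (hΛ : IsPositiveZerosOfBesselJ ν Λ)
    {p q : ℝ} (hp : 0 < p) (hpq : p ≤ q) (hq : q < 1) :
    ∃ C : ℝ, 0 < C ∧ ∀ s : ℝ, 0 < s → ∀ y ∈ Ioc (0 : ℝ) 1,
      ∫⁻ z in Ioo p q, ENNReal.ofReal (fbHeatKer ν Λ s z y * z ^ (2 * ν + 1)) ≤
        ENNReal.ofReal C := by
  have hν1 : -1 < ν := by linarith
  have hα : 0 ≤ ν + 1 / 2 := by linarith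
  have hl0 := hΛ.2.1 0
  obtain ⟨z₀, hz₀, hmin⟩ := isCompact_Icc.exists_isMinOn (nonempty_Icc.2 hpq)
    (continuous_fbEigen hν (Λ 0)).continuousOn
  obtain ⟨M, hM⟩ := isCompact_Icc.exists_bound_of_continuousOn (s := Icc (0 : ℝ) 1)
    (continuous_besselProfile hν1 (-Λ 0 ^ 2)).continuousOn
  have hM0 : 0 < M := (norm_pos_iff.2 (besselProfile_zero_pos hν1 _).ne').trans_le
    (hM 0 (left_mem_Icc.2 zero_le_one))
  set c := fbEigen ν (Λ 0) z₀ with hc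
  have hc0 : 0 < c := fbEigen_first_pos hν hΛ ⟨hp.trans_le hz₀.1, hz₀.2.trans_lt hq⟩
  have hk := fbEigenConst_pos hν hl0 (hΛ.profile 0)
  refine ⟨c⁻¹ * (fbEigenConst ν (Λ 0) * M / Λ 0), by positivity, fun s hs y hy => ?_⟩
  set b := c⁻¹ * y ^ (-(ν + 1 / 2)) with hb
  have hb0 : 0 ≤ b := mul_nonneg (inv_nonneg.2 hc0.le) (Real.rpow_nonneg hy.1.le _)
  have hyy : y ^ (-(ν + 1 / 2)) * y ^ (ν + 1 / 2) = 1 := by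
    rw [← Real.rpow_add hy.1, neg_add_cancel, Real.rpow_zero]
  calc ∫⁻ z in Ioo p q, ENNReal.ofReal (fbHeatKer ν Λ s z y * z ^ (2 * ν + 1))
      ≤ ∫⁻ z in Ioo p q, ENNReal.ofReal (b * (fbKernel ν Λ s z y * fbEigen ν (Λ 0) z)) := by
        refine setLIntegral_mono' measurableSet_Ioo fun z hz => ENNReal.ofReal_le_ofReal ?_
        have hz1 : z ∈ Ioc (0 : ℝ) 1 := ⟨hp.trans hz.1, (hz.2.trans hq).le⟩
        have hzz : z ^ (-(ν + 1 / 2)) * z ^ (2 * ν + 1) = z ^ (ν + 1 / 2) := by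
          rw [← Real.rpow_add hz1.1]
          congr 1
          ring
        have hz2 : z ^ (ν + 1 / 2) ≤ 1 := Real.rpow_le_one hz1.1.le hz1.2 hα
        have hK := fbKernel_nonneg hν hΛ hs hz1 hy
        have hcz : c ≤ fbEigen ν (Λ 0) z := hmin ⟨hz.1.le, hz.2.le⟩
        have hY := Real.rpow_nonneg hy.1.le (-(ν + 1 / 2))
        rw [fbHeatKer_eq_fbKernel hΛ s hz1.1 hy.1]
        calc z ^ (-(ν + 1 / 2)) * y ^ (-(ν + 1 / 2)) * fbKernel ν Λ s z y * z ^ (2 * ν + 1)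
            = (z ^ (-(ν + 1 / 2)) * z ^ (2 * ν + 1)) *
                (y ^ (-(ν + 1 / 2)) * fbKernel ν Λ s z y) := by ring
          _ ≤ 1 * (y ^ (-(ν + 1 / 2)) * fbKernel ν Λ s z y) := by
            rw [hzz]
            gcongr
          _ = c⁻¹ * y ^ (-(ν + 1 / 2)) * (fbKernel ν Λ s z y * c) := by
            field_simp
          _ ≤ _ := by
            rw [hb]
            gcongr
    _ ≤ ∫⁻ z in Ioc 0 1, ENNReal.ofReal (b * (fbKernel ν Λ s z y * fbEigen ν (Λ 0) z)) :=
        lintegral_mono_set fun z hz => ⟨hp.trans hz.1, (hz.2.trans hq).le⟩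
    _ = ENNReal.ofReal (b * (exp (-s * Λ 0 ^ 2) * fbEigen ν (Λ 0) y / Λ 0)) := by
        rw [← integral_fbKernel_mul hν hΛ hs hy, ← integral_const_mul,
          ofReal_integral_eq_lintegral_ofReal ((integrable_fbKernel_mul hν hΛ hs hy).const_mul b)]
        filter_upwards [ae_restrict_mem measurableSet_Ioc] with z hz
        exact mul_nonneg hb0
          (mul_nonneg (fbKernel_nonneg hν hΛ hs hz hy) (fbEigen_first_nonneg hν hΛ hz))
    _ ≤ _ := by
        refine ENNReal.ofReal_le_ofReal ?_
        have he : exp (-s * Λ 0 ^ 2) ≤ 1 := Real.exp_le_one_iff.2 (by nlinarith [sq_nonneg (Λ 0)])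
        have hE := (Real.le_norm_self _).trans (hM y ⟨hy.1.le, hy.2⟩)
        have hψ := fbEigen_first_nonneg hν hΛ hy
        calc b * (exp (-s * Λ 0 ^ 2) * fbEigen ν (Λ 0) y / Λ 0)
            ≤ b * (1 * fbEigen ν (Λ 0) y / Λ 0) := by gcongr
          _ = c⁻¹ * (fbEigenConst ν (Λ 0) * ((y ^ (-(ν + 1 / 2)) * y ^ (ν + 1 / 2)) *
                besselProfile ν (-Λ 0 ^ 2) y) / Λ 0) := by
              rw [hb, fbEigen]
              ring
          _ ≤ _ := by
              rw [hyy, one_mul]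
              gcongr

end

theorem Gamma_mul_factorial_two_mul_le {ν : ℝ} (hν : -(1 / 2) < ν) (m : ℕ) :
    Real.Gamma (ν + 1) * ((2 * m).factorial : ℝ) ≤
      4 ^ m * ((m.factorial : ℝ) * Real.Gamma ((m : ℝ) + ν + 1)) := by
  induction m with
  | zero => simp
  | succ m ih =>
    have hG := Real.Gamma_pos_of_pos (show 0 < ν + 1 by linarith)
    have hm : (0 : ℝ) ≤ m := m.cast_nonneg
    have h1 : Real.Gamma (((m + 1 : ℕ) : ℝ) + ν + 1) =
        ((m : ℝ) + ν + 1) * Real.Gamma ((m : ℝ) + ν + 1) := by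
      rw [← Real.Gamma_add_one (by linarith)]
      push_cast
      ring_nf
    rw [h1, show 2 * (m + 1) = 2 * m + 1 + 1 by ring, Nat.factorial_succ, Nat.factorial_succ,
      Nat.factorial_succ]
    push_cast
    have h3 : 0 < (m : ℝ) + ν + 1 := by linarith
    have h2 : (2 * (m : ℝ) + 1 + 1) * (2 * m + 1) ≤ 4 * (m + 1) * (m + ν + 1) := by nlinarith
    calc Real.Gamma (ν + 1) * ((2 * (m : ℝ) + 1 + 1) * ((2 * m + 1) * ((2 * m).factorial : ℝ)))
        = (2 * (m : ℝ) + 1 + 1) * (2 * m + 1) *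
            (Real.Gamma (ν + 1) * ((2 * m).factorial : ℝ)) := by ring
      _ ≤ 4 * (m + 1) * (m + ν + 1) *
            (4 ^ m * ((m.factorial : ℝ) * Real.Gamma ((m : ℝ) + ν + 1))) := by gcongr
      _ = _ := by ring

theorem besselSeries_sq_div_four_le {ν : ℝ} (hν : -(1 / 2) < ν) {u : ℝ} (hu : 0 ≤ u) :
    besselSeries ν (u ^ 2 / 4) ≤ exp u / Real.Gamma (ν + 1) := by
  have hG := Real.Gamma_pos_of_pos (show 0 < ν + 1 by linarith)
  have hν1 : -1 < ν := by linarith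
  calc besselSeries ν (u ^ 2 / 4) ≤ cosh u / Real.Gamma (ν + 1) := by
        refine hasSum_le (fun m => ?_) (summable_besselSeries hν1 _).hasSum
          ((Real.hasSum_cosh u).div_const _)
        have hg := Gamma_natCast_add_pos hν1 m
        rw [div_div, div_pow, div_div, ← pow_mul]
        have h := Gamma_mul_factorial_two_mul_le hν m
        rw [mul_comm (Real.Gamma _)] at h
        exact div_le_div_of_nonneg_left (by positivity) (by positivity) h
    _ ≤ exp u / Real.Gamma (ν + 1) := by
        gcongr
        rw [Real.cosh_eq]
        linarith [Real.exp_le_exp.2 (show -u ≤ u by linarith)]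

theorem bHeatKer_le {ν : ℝ} (hν : -(1 / 2) < ν) {t x z : ℝ} (ht : 0 < t) (hx : 0 < x)
    (hz : 0 < z) : bHeatKer ν t x z ≤
      4 / Real.Gamma (ν + 1) * t ^ (-(ν + 1)) * exp (-(z - x) ^ 2 / (4 * t)) := by
  have hG := Real.Gamma_pos_of_pos (show 0 < ν + 1 by linarith)
  have hu : 0 < x * z / (2 * t) := by positivity
  rw [bHeatKer, besselI_eq ν hu]
  have h1 := besselSeries_sq_div_four_le hν hu.le
  have h0 := besselSeries_pos (show -1 < ν by linarith)
    (show 0 ≤ (x * z / (2 * t)) ^ 2 / 4 by positivity)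
  have h2 : (x * z / (2 * t) / 2) ^ ν * (x * z) ^ (-ν) = (4 : ℝ) ^ (-ν) * t ^ (-ν) := by
    rw [show x * z / (2 * t) / 2 = (x * z) * (4 * t)⁻¹ by field_simp; norm_num,
      Real.mul_rpow (by positivity) (by positivity), Real.inv_rpow (by positivity),
      ← Real.rpow_neg (by positivity), Real.mul_rpow (by positivity) ht.le, mul_right_comm,
      ← Real.rpow_add (by positivity), add_neg_cancel, Real.rpow_zero, one_mul]
  have h3 : t ^ (-(ν + 1)) = t ^ (-ν) * t⁻¹ := by
    rw [neg_add, Real.rpow_add ht, Real.rpow_neg_one]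
  have h4 : exp (-(z - x) ^ 2 / (4 * t)) =
      exp (-(x ^ 2 + z ^ 2) / (4 * t)) * exp (x * z / (2 * t)) := by
    rw [← Real.exp_add]
    congr 1
    field_simp
    ring
  have h5 : (4 : ℝ) ^ (-ν) ≤ 4 ^ (1 : ℝ) :=
    Real.rpow_le_rpow_of_exponent_le (by norm_num) (by linarith)
  rw [Real.rpow_one] at h5
  calc (2 * t)⁻¹ * exp (-(x ^ 2 + z ^ 2) / (4 * t)) *
        ((x * z / (2 * t) / 2) ^ ν * besselSeries ν ((x * z / (2 * t)) ^ 2 / 4)) * (x * z) ^ (-ν)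
      = (2 * t)⁻¹ * exp (-(x ^ 2 + z ^ 2) / (4 * t)) *
        ((x * z / (2 * t) / 2) ^ ν * (x * z) ^ (-ν)) *
          besselSeries ν ((x * z / (2 * t)) ^ 2 / 4) := by ring
    _ ≤ (2 * t)⁻¹ * exp (-(x ^ 2 + z ^ 2) / (4 * t)) * (4 * t ^ (-ν)) *
          (exp (x * z / (2 * t)) / Real.Gamma (ν + 1)) := by
        rw [h2]
        gcongr
    _ ≤ t⁻¹ * exp (-(x ^ 2 + z ^ 2) / (4 * t)) * (4 * t ^ (-ν)) *
          (exp (x * z / (2 * t)) / Real.Gamma (ν + 1)) := by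
        gcongr
        linarith
    _ = _ := by
        rw [h3, h4]
        ring

/-- A smooth function vanishing to the left of a point is flat there. -/
theorem exists_abs_le_mul_sub_pow {a p q : ℝ} (hap : a < p) (k : ℕ) {f : ℝ → ℝ}
    (hf : ContDiff ℝ (⊤ : ℕ∞) f) (h0 : ∀ z ∈ Ioo a p, f z = 0) :
    ∃ C, 0 ≤ C ∧ ∀ z ∈ Icc p q, |f z| ≤ C * (z - p) ^ k := by
  induction k generalizing f with
  | zero =>
    obtain ⟨C, hC⟩ := isCompact_Icc.exists_bound_of_continuousOn (s := Icc p q)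
      hf.continuous.continuousOn
    refine ⟨max C 0, le_max_right _ _, fun z hz => ?_⟩
    simpa using Or.inl (hC z hz)
  | succ k ih =>
    have hf' : ContDiff ℝ (⊤ : ℕ∞) (deriv f) := ((contDiff_succ_iff_deriv (n := (⊤ : ℕ∞))).1 hf).2.2
    have hd : Differentiable ℝ f := hf.differentiable (by simp)
    obtain ⟨C, hC0, hC⟩ := ih hf' fun z hz => by
      have h1 : f =ᶠ[𝓝 z] fun _ => 0 := by
        filter_upwards [Ioo_mem_nhds hz.1 hz.2] with w hw using h0 w hw
      rw [h1.deriv_eq, deriv_const]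
    have hp : f p = 0 := by
      have h1 : closure (Ioo a p) ⊆ f ⁻¹' {0} :=
        closure_minimal h0 (isClosed_singleton.preimage hf.continuous)
      rw [closure_Ioo hap.ne] at h1
      exact h1 (right_mem_Icc.2 hap.le)
    refine ⟨C, hC0, fun z hz => ?_⟩
    have h2 := (convex_Icc p z).norm_image_sub_le_of_norm_deriv_le (f := f)
      (C := C * (z - p) ^ k) (fun w _ => hd w) (fun w hw => ?_) (left_mem_Icc.2 hz.1)
      (right_mem_Icc.2 hz.1)
    · rw [hp, sub_zero, Real.norm_eq_abs, Real.norm_of_nonneg (sub_nonneg.2 hz.1)] at h2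
      rwa [pow_succ, ← mul_assoc]
    · refine (hC w ⟨hw.1, hw.2.trans hz.2⟩).trans ?_
      have := sub_nonneg.2 hw.1
      gcongr
      exact hw.2

/-- Gaussian decay compensates the blow-up of the heat kernel at small times, against a weight
that is flat at the right end of the range of `x`. -/
theorem bHeatKer_mul_le {ν : ℝ} (hν : -(1 / 2) < ν) {n : ℕ} (hn : ν + 1 ≤ n) {t x z p : ℝ}
    (ht : 0 < t) (ht1 : t < 1) (hx : 0 < x) (hxp : x ≤ p) (hpz : p < z) :
    bHeatKer ν t x z * (z - p) ^ (2 * n) ≤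
      4 / Real.Gamma (ν + 1) * ((n.factorial : ℝ) * 4 ^ n) := by
  have hG := Real.Gamma_pos_of_pos (show 0 < ν + 1 by linarith)
  have hd : 0 < z - p := sub_pos.2 hpz
  have hd' : z - p ≤ z - x := by linarith
  have hdx : 0 < z - x := hd.trans_le hd'
  have h1 : t ^ (-(ν + 1)) ≤ (t ^ n)⁻¹ := by
    rw [← Real.rpow_natCast, ← Real.rpow_neg ht.le]
    exact Real.rpow_le_rpow_of_exponent_ge ht ht1.le (by linarith)
  have h2 : exp (-(z - x) ^ 2 / (4 * t)) ≤ (n.factorial : ℝ) * (4 * t / (z - x) ^ 2) ^ n := by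
    have h := Real.pow_div_factorial_le_exp ((z - x) ^ 2 / (4 * t)) (by positivity) n
    rw [neg_div, Real.exp_neg, inv_le_comm₀ (exp_pos _) (by positivity)]
    refine (le_of_eq ?_).trans h
    rw [mul_inv, ← inv_pow, inv_div, mul_comm, ← div_eq_mul_inv]
  calc bHeatKer ν t x z * (z - p) ^ (2 * n)
      ≤ 4 / Real.Gamma (ν + 1) * t ^ (-(ν + 1)) * exp (-(z - x) ^ 2 / (4 * t)) *
          (z - x) ^ (2 * n) := by
        gcongr
        exact bHeatKer_le hν ht hx (by linarith)
    _ ≤ 4 / Real.Gamma (ν + 1) * (t ^ n)⁻¹ * ((n.factorial : ℝ) * (4 * t / (z - x) ^ 2) ^ n) *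
          (z - x) ^ (2 * n) := by gcongr
    _ = _ := by
        rw [div_pow, mul_pow, pow_mul]
        field_simp

theorem exists_bHeatKer_mul_abs_le {ν : ℝ} (hν : -(1 / 2) < ν) {p q : ℝ} (hp : 0 < p)
    {f : ℝ → ℝ} (hf : ContDiff ℝ (⊤ : ℕ∞) f) (h0 : ∀ z ∈ Ioo 0 p, f z = 0) :
    ∃ C, 0 < C ∧ ∀ x ∈ Ioc 0 p, ∀ z ∈ Ioc 0 q, ∀ t, 0 < t → t < 1 →
      bHeatKer ν t x z * |f z| ≤ C := by
  obtain ⟨n, hn⟩ := exists_nat_ge (ν + 1)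
  obtain ⟨C, hC0, hC⟩ := exists_abs_le_mul_sub_pow (q := q) hp (2 * n) hf h0
  have hG := Real.Gamma_pos_of_pos (show 0 < ν + 1 by linarith)
  set K := 4 / Real.Gamma (ν + 1) * ((n.factorial : ℝ) * 4 ^ n) with hK
  have hK0 : 0 < K := by positivity
  have hfp : f p = 0 := by
    have h1 : closure (Ioo 0 p) ⊆ f ⁻¹' {0} :=
      closure_minimal h0 (isClosed_singleton.preimage hf.continuous)
    rw [closure_Ioo hp.ne] at h1
    exact h1 (right_mem_Icc.2 hp.le)
  refine ⟨C * K + 1, by positivity, fun x hx z hz t ht ht1 => ?_⟩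
  rcases le_or_gt z p with h | h
  · have h1 : f z = 0 := by
      rcases h.eq_or_lt with rfl | h
      · exact hfp
      · exact h0 z ⟨hz.1, h⟩
    rw [h1, abs_zero, mul_zero]
    positivity
  · have hb : 0 ≤ bHeatKer ν t x z := by
      have hu : 0 < x * z / (2 * t) := by have := hx.1; have := hz.1; positivity
      have := hx.1
      have := hz.1
      have := besselSeries_pos (show -1 < ν by linarith)
        (show 0 ≤ (x * z / (2 * t)) ^ 2 / 4 by positivity)
      rw [bHeatKer, besselI_eq ν hu]
      positivity
    calc bHeatKer ν t x z * |f z| ≤ bHeatKer ν t x z * (C * (z - p) ^ (2 * n)) := by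
          gcongr
          exact hC z ⟨h.le, hz.2⟩
      _ = C * (bHeatKer ν t x z * (z - p) ^ (2 * n)) := by ring
      _ ≤ C * K := by
          gcongr
          exact bHeatKer_mul_le hν hn ht ht1 hx.1 hx.2 h
      _ ≤ C * K + 1 := by linarith

/-- Bound for the Duhamel error kernel `R_t^{[1]}(x,y)` (Lemma 3.7, case j = 1). -/
theorem duhamel_kernel_bound (ν : ℝ) (hν : -(1/2 : ℝ) < ν)
    (Λ : ℕ → ℝ) (hΛ : IsPositiveZerosOfBesselJ ν Λ)
    (ρ : ℝ → ℝ) (hρ : ContDiff ℝ (⊤ : ℕ∞) ρ)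
    (hρ1 : ∀ x ∈ Ioc (0:ℝ) (5101/10000), ρ x = 1)
    (hρ0 : ∀ x : ℝ, 2/3 ≤ x → ρ x = 0)
    (hρ'' : Function.support (deriv (deriv ρ)) ⊆ Ioo (1/2 : ℝ) (2/3)) :
    ∃ C : ℝ, 0 < C ∧
      ∀ x ∈ Ioc (0:ℝ) (5101/10000), ∀ y ∈ Ioc (0:ℝ) (5101/10000),
        ∀ t : ℝ, 0 < t → t < 1 →
        ∫⁻ s in Ioo (0:ℝ) t, ∫⁻ z in Ioi (0:ℝ),
            ENNReal.ofReal (bHeatKer ν (t - s) x z * |deriv (deriv ρ) z| *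
              fbHeatKer ν Λ s z y * z ^ (2*ν+1))
          ≤ ENNReal.ofReal C := by
  have hρd : ContDiff ℝ (⊤ : ℕ∞) (deriv (deriv ρ)) :=
    ((contDiff_succ_iff_deriv (n := (⊤ : ℕ∞))).1
      ((contDiff_succ_iff_deriv (n := (⊤ : ℕ∞))).1 hρ).2.2).2.2
  have hflat : ∀ z ∈ Ioo (0 : ℝ) (5101/10000), deriv (deriv ρ) z = 0 := fun z hz => by
    have h1 : ρ =ᶠ[𝓝 z] fun _ => 1 := by
      filter_upwards [Ioo_mem_nhds hz.1 hz.2] with w hw using hρ1 w (Ioo_subset_Ioc_self hw)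
    have h2 : deriv ρ =ᶠ[𝓝 z] fun _ => 0 := h1.deriv.trans (by simp)
    rw [h2.deriv_eq, deriv_const]
  obtain ⟨C₁, hC₁, h₁⟩ := exists_bHeatKer_mul_abs_le hν (q := 2/3) (by norm_num) hρd hflat
  obtain ⟨C₂, hC₂, h₂⟩ := lintegral_fbHeatKer_le hν hΛ (p := 1/2) (q := 2/3) (by norm_num)
    (by norm_num) (by norm_num)
  refine ⟨C₁ * C₂, by positivity, fun x hx y hy t ht ht1 => ?_⟩
  have hy1 : y ∈ Ioc (0 : ℝ) 1 := ⟨hy.1, hy.2.trans (by norm_num)⟩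
  have hinner : ∀ s ∈ Ioo (0 : ℝ) t, ∫⁻ z in Ioi (0:ℝ),
      ENNReal.ofReal (bHeatKer ν (t - s) x z * |deriv (deriv ρ) z| *
        fbHeatKer ν Λ s z y * z ^ (2*ν+1)) ≤ ENNReal.ofReal (C₁ * C₂) := fun s hs => by
    calc _ ≤ ∫⁻ z in Ioi (0:ℝ), (Ioo (1/2 : ℝ) (2/3)).indicator (fun z => ENNReal.ofReal C₁ *
          ENNReal.ofReal (fbHeatKer ν Λ s z y * z ^ (2*ν+1))) z := by
          refine setLIntegral_mono' measurableSet_Ioi fun z hz => ?_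
          by_cases hzI : z ∈ Ioo (1/2 : ℝ) (2/3)
          · rw [indicator_of_mem hzI, ← ENNReal.ofReal_mul hC₁.le]
            refine ENNReal.ofReal_le_ofReal ?_
            have hz0 : 0 < z := hz
            have h3 := fbHeatKer_nonneg hν hΛ hs.1 (x := z) ⟨hz0, by linarith [hzI.2]⟩ hy1
            rw [← mul_assoc]
            gcongr
            exact h₁ x hx z ⟨hz0, hzI.2.le⟩ (t - s) (by linarith [hs.2]) (by linarith [hs.1])
          · rw [indicator_of_notMem hzI, Function.notMem_support.1 fun h => hzI (hρ'' h)]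
            simp
      _ ≤ ∫⁻ z, (Ioo (1/2 : ℝ) (2/3)).indicator (fun z => ENNReal.ofReal C₁ *
          ENNReal.ofReal (fbHeatKer ν Λ s z y * z ^ (2*ν+1))) z := setLIntegral_le_lintegral _ _
      _ = ENNReal.ofReal C₁ * ∫⁻ z in Ioo (1/2 : ℝ) (2/3),
          ENNReal.ofReal (fbHeatKer ν Λ s z y * z ^ (2*ν+1)) := by
          rw [lintegral_indicator measurableSet_Ioo, lintegral_const_mul' _ _ ENNReal.ofReal_ne_top]
      _ ≤ ENNReal.ofReal C₁ * ENNReal.ofReal C₂ := by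
          gcongr
          exact h₂ s hs.1 y hy1
      _ = _ := (ENNReal.ofReal_mul hC₁.le).symm
  calc _ ≤ ∫⁻ _ in Ioo (0:ℝ) t, ENNReal.ofReal (C₁ * C₂) :=
        setLIntegral_mono' measurableSet_Ioo hinner
    _ = ENNReal.ofReal (C₁ * C₂) * ENNReal.ofReal t := by simp
    _ ≤ ENNReal.ofReal (C₁ * C₂) * 1 := by
        gcongr
        exact ENNReal.ofReal_le_one.2 ht1.le
    _ = _ := mul_one _
end

section
/- Assume ν > −1/2. There exists a constant C such that for every f ∈ L¹((0,1), μ), ∫_0^1 sup_{t>1} |𝒫_t f(x)| dμ(x) ≤ C ∫_0^1 |f(y)| dμ(y); that is, the maximal operator 𝓜^∞ f(x) = sup_{t>1} |𝒫_t f(x)| is bounded on L¹((0,1), μ). -/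
open MeasureTheory Real Set Filter Topology
open scoped ENNReal NNReal

/-- The coefficients of the entire function `w ↦ (√w)^{-ν} J_ν(2√w)`. -/
noncomputable def besselCoeff (ν : ℝ) (m : ℕ) : ℝ :=
  (-1 : ℝ) ^ m / ((m.factorial : ℝ) * Real.Gamma ((m : ℝ) + ν + 1))

/-- The entire function `F_ν` with `J_ν(z) = (z/2)^ν F_ν((z/2)^2)`. -/
noncomputable def besselEntire (ν w : ℝ) : ℝ := ∑' m : ℕ, besselCoeff ν m * w ^ m

theorem gamma_add_nat_lower {ν : ℝ} (hν : -(1/2 : ℝ) < ν) (m : ℕ) :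
    (1/2 : ℝ) ^ m * Real.Gamma (ν + 1) ≤ Real.Gamma ((m : ℝ) + ν + 1) := by
  induction m with
  | zero => simp
  | succ k ih =>
    have hk : (0 : ℝ) ≤ k := k.cast_nonneg
    have hrec : Real.Gamma (((k + 1 : ℕ) : ℝ) + ν + 1) =
        ((k : ℝ) + ν + 1) * Real.Gamma ((k : ℝ) + ν + 1) := by
      rw [← Real.Gamma_add_one (by linarith)]
      congr 1
      push_cast
      ring
    have hpos : 0 < Real.Gamma ((k : ℝ) + ν + 1) := Real.Gamma_pos_of_pos (by linarith)
    rw [hrec, pow_succ]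
    nlinarith

theorem abs_besselCoeff_le {ν : ℝ} (hν : -(1/2 : ℝ) < ν) (m : ℕ) :
    |besselCoeff ν m| ≤ (Real.Gamma (ν + 1))⁻¹ * (2 ^ m / (m.factorial : ℝ)) := by
  have hΓ : 0 < Real.Gamma (ν + 1) := Real.Gamma_pos_of_pos (by linarith)
  have hlow := gamma_add_nat_lower hν m
  have hfac : (0 : ℝ) < m.factorial := by exact_mod_cast m.factorial_pos
  have hpos : 0 < (1/2 : ℝ) ^ m * Real.Gamma (ν + 1) := by positivity
  have hpos' : 0 < Real.Gamma ((m : ℝ) + ν + 1) := hpos.trans_le hlow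
  rw [besselCoeff, abs_div, abs_pow, abs_neg, abs_one, one_pow, abs_of_pos (mul_pos hfac hpos')]
  calc 1 / ((m.factorial : ℝ) * Real.Gamma ((m : ℝ) + ν + 1))
      ≤ 1 / ((m.factorial : ℝ) * ((1/2 : ℝ) ^ m * Real.Gamma (ν + 1))) := by gcongr
    _ = _ := by
      rw [one_div_pow]
      field_simp

theorem summable_abs_besselCoeff {ν : ℝ} (hν : -(1/2 : ℝ) < ν) (R : ℝ) :
    Summable fun m : ℕ => |besselCoeff ν m| * |R| ^ m := by
  refine Summable.of_nonneg_of_le (fun m => by positivity) (fun m => ?_)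
    ((Real.summable_pow_div_factorial (2 * |R|)).mul_left (Real.Gamma (ν + 1))⁻¹)
  calc |besselCoeff ν m| * |R| ^ m
      ≤ (Real.Gamma (ν + 1))⁻¹ * (2 ^ m / (m.factorial : ℝ)) * |R| ^ m := by
        gcongr
        exact abs_besselCoeff_le hν m
    _ = _ := by rw [mul_pow]; ring

theorem summable_besselCoeff {ν : ℝ} (hν : -(1/2 : ℝ) < ν) (w : ℝ) :
    Summable fun m : ℕ => besselCoeff ν m * w ^ m := by
  refine Summable.of_norm ?_
  simpa [abs_mul, abs_pow] using summable_abs_besselCoeff hν w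

theorem besselCoeff_succ_mul (ν : ℝ) (m : ℕ) :
    besselCoeff ν (m + 1) * ((m + 1 : ℕ) : ℝ) = -besselCoeff (ν + 1) m := by
  have hm : ((m + 1 : ℕ) : ℝ) ≠ 0 := by positivity
  have harg : ((m + 1 : ℕ) : ℝ) + ν + 1 = (m : ℝ) + (ν + 1) + 1 := by push_cast; ring
  rw [besselCoeff, besselCoeff, harg, Nat.factorial_succ, Nat.cast_mul, pow_succ, mul_assoc,
    div_mul_eq_mul_div, mul_comm ((-1 : ℝ) ^ m * -1), mul_div_mul_left _ _ hm]
  ring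

theorem hasDerivAt_besselEntire {ν : ℝ} (hν : -(1/2 : ℝ) < ν) (w : ℝ) :
    HasDerivAt (besselEntire ν) (-besselEntire (ν + 1) w) w := by
  set R : ℝ := |w| + 1 with hR
  have hRpos : 0 < R := by positivity
  have hν' : -(1/2 : ℝ) < ν + 1 := by linarith
  have hu : Summable fun m : ℕ => |besselCoeff ν m * m| * R ^ (m - 1) := by
    rw [← summable_nat_add_iff 1]
    have h := summable_abs_besselCoeff hν' R
    rw [abs_of_pos hRpos] at h
    refine h.congr fun m => ?_
    rw [besselCoeff_succ_mul, abs_neg, Nat.add_sub_cancel]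
  have hmem : w ∈ Metric.ball (0 : ℝ) R := by simp [hR]
  have hderiv := hasDerivAt_tsum_of_isPreconnected hu Metric.isOpen_ball
    (convex_ball (0 : ℝ) R).isPreconnected
    (g := fun m w => besselCoeff ν m * w ^ m)
    (g' := fun m w => besselCoeff ν m * (m * w ^ (m - 1)))
    (fun m y _ => (hasDerivAt_pow m y).const_mul _)
    (fun m y hy => ?_) (Metric.mem_ball_self hRpos) (summable_besselCoeff hν 0) hmem
  · have hsum : ∑' m : ℕ, besselCoeff ν m * (m * w ^ (m - 1)) = -besselEntire (ν + 1) w := by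
      have hs : Summable fun m : ℕ => besselCoeff ν (m + 1) * (((m + 1 : ℕ) : ℝ) * w ^ m) := by
        refine (summable_besselCoeff hν' w).neg.congr fun m => ?_
        rw [← mul_assoc, besselCoeff_succ_mul, neg_mul]
      have hs' : Summable fun m : ℕ => besselCoeff ν m * ((m : ℝ) * w ^ (m - 1)) :=
        (summable_nat_add_iff 1).1 hs
      rw [hs'.tsum_eq_zero_add, besselEntire, ← tsum_neg]
      simp only [Nat.cast_zero, zero_mul, mul_zero, zero_add, Nat.add_sub_cancel]
      refine tsum_congr fun m => ?_
      rw [← mul_assoc, besselCoeff_succ_mul, neg_mul]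
    rw [← hsum]
    exact hderiv
  · have hy' : |y| ≤ R := by
      have := Metric.mem_ball.1 hy
      rw [Real.dist_0_eq_abs] at this
      exact this.le
    rw [← mul_assoc, norm_mul, norm_pow, Real.norm_eq_abs, Real.norm_eq_abs]
    gcongr

theorem besselEntire_recurrence {ν : ℝ} (hν : -(1/2 : ℝ) < ν) (w : ℝ) :
    w * besselEntire (ν + 2) w = (ν + 1) * besselEntire (ν + 1) w - besselEntire ν w := by
  have h0 := summable_besselCoeff hν w
  have h1 := summable_besselCoeff (show -(1/2 : ℝ) < ν + 1 by linarith) w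
  have h2 := summable_besselCoeff (show -(1/2 : ℝ) < ν + 2 by linarith) w
  have hcoeff (m : ℕ) : (ν + 1) * besselCoeff (ν + 1) m - besselCoeff ν m =
      -(besselCoeff (ν + 1) m * m) := by
    have hm : (0 : ℝ) ≤ m := m.cast_nonneg
    have hpos : 0 < (m : ℝ) + ν + 1 := by linarith
    have hfac : (m.factorial : ℝ) ≠ 0 := by positivity
    have hΓ : Real.Gamma ((m : ℝ) + ν + 1) ≠ 0 := (Real.Gamma_pos_of_pos hpos).ne'
    rw [besselCoeff, besselCoeff,
      show (m : ℝ) + (ν + 1) + 1 = ((m : ℝ) + ν + 1) + 1 by ring, Real.Gamma_add_one hpos.ne']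
    field_simp
    ring
  have hterm : (ν + 1) * besselEntire (ν + 1) w - besselEntire ν w =
      ∑' m : ℕ, -(besselCoeff (ν + 1) m * m) * w ^ m := by
    rw [besselEntire, besselEntire, ← tsum_mul_left, ← (h1.mul_left (ν + 1)).tsum_sub h0]
    refine tsum_congr fun m => ?_
    rw [← hcoeff]
    ring
  have hs : Summable fun m : ℕ => -(besselCoeff (ν + 1) m * m) * w ^ m := by
    refine ((h1.mul_left (ν + 1)).sub h0).congr fun m => ?_
    rw [← hcoeff]
    ring
  rw [hterm, hs.tsum_eq_zero_add, besselEntire, ← tsum_mul_left]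
  simp only [Nat.cast_zero, mul_zero, neg_zero, zero_mul, zero_add]
  refine tsum_congr fun m => ?_
  rw [besselCoeff_succ_mul, show ν + 1 + 1 = ν + 2 by ring]
  ring

theorem besselJ_eq_rpow_mul (ν : ℝ) {x : ℝ} (hx : 0 < x) :
    besselJ ν x = (x / 2) ^ ν * besselEntire ν ((x / 2) ^ 2) := by
  rw [besselJ, besselEntire, ← tsum_mul_left]
  refine tsum_congr fun m => ?_
  rw [Real.rpow_add (by positivity), ← Nat.cast_ofNat, ← Nat.cast_mul, Real.rpow_natCast, pow_mul,
    besselCoeff]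
  ring

/-- The normalised Bessel function `z ↦ (z/2)^{-ν} J_ν(z)`. -/
noncomputable def besselNorm (ν z : ℝ) : ℝ := besselEntire ν ((z / 2) ^ 2)

/-- The derivative of `besselNorm ν`. -/
noncomputable def besselNormDeriv (ν z : ℝ) : ℝ := -(z / 2) * besselNorm (ν + 1) z

/-- The energy `g² + g'²` of `g = besselNorm ν`. -/
noncomputable def besselEnergy (ν z : ℝ) : ℝ := besselNorm ν z ^ 2 + besselNormDeriv ν z ^ 2

theorem hasDerivAt_besselNorm {ν : ℝ} (hν : -(1/2 : ℝ) < ν) (z : ℝ) :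
    HasDerivAt (besselNorm ν) (besselNormDeriv ν z) z := by
  have hin : HasDerivAt (fun z : ℝ => (z / 2) ^ 2) (z / 2) z := by
    refine (((hasDerivAt_id z).div_const 2).pow 2).congr_deriv ?_
    simp only [id, Nat.add_one_sub_one, pow_one]
    ring
  refine ((hasDerivAt_besselEntire hν ((z / 2) ^ 2)).comp z hin).congr_deriv ?_
  rw [besselNormDeriv, besselNorm]
  ring

theorem hasDerivAt_besselNormDeriv {ν : ℝ} (hν : -(1/2 : ℝ) < ν) (z : ℝ) :
    HasDerivAt (besselNormDeriv ν)
      ((ν + 1/2) * besselNorm (ν + 1) z - besselNorm ν z) z := by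
  have hlin : HasDerivAt (fun z : ℝ => -(z / 2)) (-(1 / 2)) z :=
    ((hasDerivAt_id z).div_const 2).neg
  refine (hlin.mul
    (hasDerivAt_besselNorm (show -(1/2 : ℝ) < ν + 1 by linarith) z)).congr_deriv ?_
  have hrec := besselEntire_recurrence hν ((z / 2) ^ 2)
  rw [besselNormDeriv, show ν + 1 + 1 = ν + 2 by ring]
  simp only [besselNorm] at *
  linear_combination hrec

theorem hasDerivAt_besselEnergy {ν : ℝ} (hν : -(1/2 : ℝ) < ν) (z : ℝ) :
    HasDerivAt (besselEnergy ν) (-(2 * ν + 1) * (z / 2) * besselNorm (ν + 1) z ^ 2) z := by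
  refine (((hasDerivAt_besselNorm hν z).pow 2).add
    ((hasDerivAt_besselNormDeriv hν z).pow 2)).congr_deriv ?_
  simp only [besselNormDeriv]
  push_cast
  ring

theorem besselEnergy_antitoneOn {ν : ℝ} (hν : -(1/2 : ℝ) < ν) :
    AntitoneOn (besselEnergy ν) (Ici 0) := by
  refine antitoneOn_of_hasDerivWithinAt_nonpos (convex_Ici 0)
    (fun z _ => (hasDerivAt_besselEnergy hν z).continuousAt.continuousWithinAt)
    (fun z _ => (hasDerivAt_besselEnergy hν z).hasDerivWithinAt) (fun z hz => ?_)
  rw [interior_Ici] at hz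
  have hz' : 0 < z := hz
  have h2 : 0 < 2 * ν + 1 := by linarith
  have : 0 ≤ (2 * ν + 1) * (z / 2) * besselNorm (ν + 1) z ^ 2 := by positivity
  linarith

theorem rpow_mul_besselEnergy_monotoneOn {ν : ℝ} (hν : -(1/2 : ℝ) < ν) :
    MonotoneOn (fun z => z ^ (4 * ν + 2) * besselEnergy ν z) (Ioi 0) := by
  have hd (z : ℝ) (hz : 0 < z) := (Real.hasDerivAt_rpow_const (p := 4 * ν + 2)
    (Or.inl hz.ne')).mul (hasDerivAt_besselEnergy hν z)
  refine monotoneOn_of_hasDerivWithinAt_nonneg (convex_Ioi 0)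
    (fun z hz => (hd z hz).continuousAt.continuousWithinAt)
    (fun z hz => (hd z (interior_subset hz)).hasDerivWithinAt) (fun z hz => ?_)
  rw [interior_Ioi] at hz
  have hz' : 0 < z := hz
  have hp : 0 < 4 * ν + 2 := by linarith
  have hsplit : z ^ (4 * ν + 2) = z ^ (4 * ν + 2 - 1) * z := by
    rw [← Real.rpow_add_one hz'.ne']
    ring_nf
  have : 0 ≤ (4 * ν + 2) * z ^ (4 * ν + 2 - 1) * besselNorm ν z ^ 2 := by positivity
  rw [hsplit, besselEnergy, besselNormDeriv]
  linarith

theorem besselNorm_zero (ν : ℝ) : besselNorm ν 0 = (Real.Gamma (ν + 1))⁻¹ := by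
  rw [besselNorm, besselEntire, tsum_eq_single 0]
  · simp [besselCoeff]
  · intro m hm
    simp [hm]

theorem besselEnergy_pos {ν : ℝ} (hν : -(1/2 : ℝ) < ν) {z : ℝ} (hz : 0 < z) :
    0 < besselEnergy ν z := by
  have h0 : 0 < besselEnergy ν 0 := by
    have hΓ : 0 < Real.Gamma (ν + 1) := Real.Gamma_pos_of_pos (by linarith)
    have : 0 < besselNorm ν 0 := by rw [besselNorm_zero]; positivity
    rw [besselEnergy]
    positivity
  have hev : ∀ᶠ y in 𝓝[>] (0 : ℝ), 0 < besselEnergy ν y :=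
    ((hasDerivAt_besselEnergy hν 0).continuousAt.eventually (lt_mem_nhds h0)).filter_mono
      nhdsWithin_le_nhds
  obtain ⟨y, hy, hyz⟩ := (hev.and (Ioo_mem_nhdsGT hz)).exists
  have hmono := rpow_mul_besselEnergy_monotoneOn hν hyz.1 hz hyz.2.le
  have hypos : 0 < y := hyz.1
  have : 0 < y ^ (4 * ν + 2) * besselEnergy ν y := by positivity
  exact pos_of_mul_pos_right (this.trans_le hmono) (by positivity)

theorem abs_besselNorm_le {ν : ℝ} (hν : -(1/2 : ℝ) < ν) {z : ℝ} (hz : 0 ≤ z) :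
    |besselNorm ν z| ≤ (Real.Gamma (ν + 1))⁻¹ := by
  have hΓ : 0 < Real.Gamma (ν + 1) := Real.Gamma_pos_of_pos (by linarith)
  have h := besselEnergy_antitoneOn hν (mem_Ici.2 le_rfl) hz hz
  refine abs_le_of_sq_le_sq ?_ (by positivity)
  have h0 : besselEnergy ν 0 = (Real.Gamma (ν + 1))⁻¹ ^ 2 := by
    simp [besselEnergy, besselNormDeriv, besselNorm_zero]
  rw [h0, besselEnergy] at h
  nlinarith [sq_nonneg (besselNormDeriv ν z)]

theorem besselNorm_eq_zero_of_besselJ_eq_zero {ν z : ℝ} (hz : 0 < z) (h : besselJ ν z = 0) :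
    besselNorm ν z = 0 := by
  rw [besselJ_eq_rpow_mul ν hz] at h
  exact (mul_eq_zero.1 h).resolve_left (by positivity)

theorem besselJ_add_one_eq (ν : ℝ) {z : ℝ} (hz : 0 < z) :
    besselJ (ν + 1) z = -((z / 2) ^ ν * besselNormDeriv ν z) := by
  rw [besselJ_eq_rpow_mul _ hz, Real.rpow_add_one (by positivity), besselNormDeriv, besselNorm]
  ring

theorem besselNorm_zeros_gap {ν : ℝ} (hν : -(1/2 : ℝ) < ν) {r a b : ℝ} (hr : 0 < r) (hra : r ≤ a)
    (hab : a < b) (ha : besselNorm ν a = 0) (hb : besselNorm ν b = 0) :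
    (1 + (2 * ν + 1) / r)⁻¹ ≤ b - a := by
  have ha0 : 0 < a := hr.trans_le hra
  have h2 : 0 < 2 * ν + 1 := by linarith
  obtain ⟨ξ, hξ, hξ0⟩ := exists_hasDerivAt_eq_zero hab
    (fun z _ => (hasDerivAt_besselNorm hν z).continuousAt.continuousWithinAt) (ha.trans hb.symm)
    (fun z _ => hasDerivAt_besselNorm hν z)
  set s := √(besselEnergy ν a) with hs
  have hspos : 0 < s := Real.sqrt_pos.2 (besselEnergy_pos hν ha0)
  have hs2 : s ^ 2 = besselEnergy ν a := Real.sq_sqrt (besselEnergy_pos hν ha0).le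
  have hsa : |besselNormDeriv ν a| = s := by
    rw [hs, besselEnergy, ha]
    simp [Real.sqrt_sq_eq_abs]
  set K := 1 + (2 * ν + 1) / r with hK
  have hKpos : 0 < K := by positivity
  have hbound (z : ℝ) (hz : z ∈ Icc a ξ) :
      ‖(ν + 1/2) * besselNorm (ν + 1) z - besselNorm ν z‖ ≤ K * s := by
    have hz0 : 0 < z := ha0.trans_le hz.1
    have hE := besselEnergy_antitoneOn hν (mem_Ici.2 ha0.le) (mem_Ici.2 hz0.le) hz.1
    rw [← hs2, besselEnergy] at hE
    have hg : |besselNorm ν z| ≤ s :=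
      abs_le_of_sq_le_sq (by nlinarith [sq_nonneg (besselNormDeriv ν z)]) hspos.le
    have hh : |besselNormDeriv ν z| ≤ s :=
      abs_le_of_sq_le_sq (by nlinarith [sq_nonneg (besselNorm ν z)]) hspos.le
    have hode : (ν + 1/2) * besselNorm (ν + 1) z =
        -((2 * ν + 1) / z * besselNormDeriv ν z) := by
      rw [besselNormDeriv]
      field_simp
    calc ‖(ν + 1/2) * besselNorm (ν + 1) z - besselNorm ν z‖
        ≤ |(ν + 1/2) * besselNorm (ν + 1) z| + |besselNorm ν z| := norm_sub_le _ _
      _ = (2 * ν + 1) / z * |besselNormDeriv ν z| + |besselNorm ν z| := by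
          rw [hode, abs_neg, abs_mul, abs_of_pos (div_pos h2 hz0)]
      _ ≤ (2 * ν + 1) / r * s + s := by
          gcongr
          exact hra.trans hz.1
      _ = K * s := by rw [hK]; ring
  have hmvt := (convex_Icc a ξ).norm_image_sub_le_of_norm_hasDerivWithin_le
    (fun z _ => (hasDerivAt_besselNormDeriv hν z).hasDerivWithinAt) hbound
    (left_mem_Icc.2 hξ.1.le) (right_mem_Icc.2 hξ.1.le)
  rw [hξ0, zero_sub, norm_neg, Real.norm_eq_abs, hsa, Real.norm_eq_abs,
    abs_of_pos (sub_pos.2 hξ.1)] at hmvt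
  have h1 : 1 ≤ K * (ξ - a) := by
    by_contra! hlt
    nlinarith
  rw [inv_le_iff_one_le_mul₀' hKpos]
  nlinarith [hξ.2]

theorem summable_exp_neg_half_zeros {ν : ℝ} (hν : -(1/2 : ℝ) < ν) {Λ : ℕ → ℝ}
    (hΛ : IsPositiveZerosOfBesselJ ν Λ) : Summable fun n => Real.exp (-(Λ n / 2)) := by
  obtain ⟨hmono, hpos, hzero, -⟩ := hΛ
  set δ := (1 + (2 * ν + 1) / Λ 0)⁻¹ with hδ
  have hΛ0 := hpos 0
  have h2 : 0 < 2 * ν + 1 := by linarith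
  have hδpos : 0 < δ := by positivity
  have hg (n : ℕ) : besselNorm ν (Λ n) = 0 :=
    besselNorm_eq_zero_of_besselJ_eq_zero (hpos n) (hzero n)
  have hgrow (n : ℕ) : n * δ ≤ Λ n := by
    induction n with
    | zero => simpa using hΛ0.le
    | succ k ih =>
      have := besselNorm_zeros_gap hν hΛ0 (hmono.monotone k.zero_le) (hmono k.lt_succ_self)
        (hg k) (hg (k + 1))
      push_cast
      linarith
  refine Summable.of_nonneg_of_le (fun n => (Real.exp_pos _).le) (fun n => ?_)
    (Real.summable_exp_nat_mul_iff.2 (show -(δ / 2) < 0 by linarith))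
  have := hgrow n
  exact Real.exp_le_exp.2 (by linarith)

theorem exists_rpow_le_mul_exp (p : ℝ) {c r : ℝ} (hc : 0 < c) (hr : 0 < r) :
    ∃ C : ℝ, 0 < C ∧ ∀ z, r ≤ z → z ^ p ≤ C * Real.exp (c * z) := by
  obtain ⟨N, hN⟩ := exists_nat_gt p
  refine ⟨max 1 (r ^ (p - N)) * (N.factorial / c ^ N), by positivity, fun z hz => ?_⟩
  have hz0 : 0 < z := hr.trans_le hz
  have hexp := Real.pow_div_factorial_le_exp (c * z) (by positivity) N
  calc z ^ p = z ^ (p - N) * z ^ N := by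
        rw [← Real.rpow_natCast z N, ← Real.rpow_add hz0, sub_add_cancel]
    _ ≤ max 1 (r ^ (p - N)) * z ^ N := by
        gcongr
        exact (Real.rpow_le_rpow_of_nonpos hr hz (by linarith)).trans (le_max_right _ _)
    _ = max 1 (r ^ (p - N)) * (N.factorial / c ^ N) * ((c * z) ^ N / N.factorial) := by
        rw [mul_pow]
        field_simp
    _ ≤ _ := by gcongr

theorem exists_abs_phiFB_le {ν : ℝ} (hν : -(1/2 : ℝ) < ν) {Λ : ℕ → ℝ}
    (hΛ : IsPositiveZerosOfBesselJ ν Λ) :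
    ∃ C : ℝ, 0 < C ∧ ∀ n, ∀ x ∈ Ioo (0 : ℝ) 1, |phiFB ν Λ n x| ≤ C * Real.exp (Λ n / 4) := by
  obtain ⟨hmono, hpos, hzero, -⟩ := hΛ
  have hΛ0 := hpos 0
  have hE0 := besselEnergy_pos hν hΛ0
  have hΓ : 0 < Real.Gamma (ν + 1) := Real.Gamma_pos_of_pos (by linarith)
  obtain ⟨A, hA, hAexp⟩ := exists_rpow_le_mul_exp (2 * ν + 1/2) (c := 1/4) (by norm_num) hΛ0
  set s := Λ 0 ^ (2 * ν + 1) * √(besselEnergy ν (Λ 0)) with hs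
  have hspos : 0 < s := by positivity
  refine ⟨√2 / s * (Real.Gamma (ν + 1))⁻¹ * A, by positivity, fun n x hx => ?_⟩
  have hz := hpos n
  have hx0 : 0 < x := hx.1
  set z := Λ n with hzdef
  have hdz : s ≤ z ^ (2 * ν + 1) * |besselNormDeriv ν z| := by
    have h := rpow_mul_besselEnergy_monotoneOn hν (mem_Ioi.2 hΛ0) (mem_Ioi.2 hz)
      (hmono.monotone n.zero_le)
    have hEz : besselEnergy ν z = besselNormDeriv ν z ^ 2 := by
      rw [besselEnergy, besselNorm_eq_zero_of_besselJ_eq_zero hz (hzero n)]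
      ring
    have hsq (y : ℝ) (hy : 0 < y) : y ^ (4 * ν + 2) = (y ^ (2 * ν + 1)) ^ 2 := by
      rw [← Real.rpow_mul_natCast hy.le]
      congr 1
      push_cast
      ring
    simp only [hEz, hsq _ hΛ0, hsq _ hz] at h
    refine le_of_sq_le_sq ?_ (by positivity)
    rw [hs, mul_pow, mul_pow, Real.sq_sqrt hE0.le, sq_abs]
    exact h
  have hJ1 : |z * besselJ (ν + 1) z| = z * (z / 2) ^ ν * |besselNormDeriv ν z| := by
    rw [besselJ_add_one_eq ν hz, abs_mul, abs_neg, abs_mul, abs_of_pos hz,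
      abs_of_pos (show 0 < (z / 2) ^ ν by positivity), mul_assoc]
  have hJ : besselJ ν (z * x) * x ^ (-ν) = (z / 2) ^ ν * besselNorm ν (z * x) := by
    rw [besselJ_eq_rpow_mul ν (by positivity), besselNorm,
      show z * x / 2 = z / 2 * x by ring, Real.mul_rpow (by positivity) hx0.le,
      Real.rpow_neg hx0.le]
    field_simp
  have hd : 0 < |besselNormDeriv ν z| :=
    pos_of_mul_pos_right (hspos.trans_le hdz) (by positivity)
  have hg : |besselNorm ν (z * x)| ≤ (Real.Gamma (ν + 1))⁻¹ :=
    abs_besselNorm_le hν (by positivity)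
  have hpow : √z / z * z ^ (2 * ν + 1) = z ^ (2 * ν + 1/2) := by
    rw [Real.sqrt_eq_rpow, ← Real.rpow_sub_one hz.ne', ← Real.rpow_add hz]
    congr 1
    ring
  have hφ : |phiFB ν Λ n x| = √2 * √z / (z * |besselNormDeriv ν z|) * |besselNorm ν (z * x)| := by
    rw [phiFB, mul_assoc _ (besselJ _ _), hJ, hJ1, abs_mul, abs_mul, abs_mul,
      abs_of_pos (show 0 < (z / 2) ^ ν by positivity),
      abs_of_pos (show 0 < √2 / (z * (z / 2) ^ ν * |besselNormDeriv ν z|) by positivity),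
      abs_of_pos (show 0 < √z by positivity)]
    field_simp
  calc |phiFB ν Λ n x|
      = √2 * (√z / z) * |besselNormDeriv ν z|⁻¹ * |besselNorm ν (z * x)| := by
        rw [hφ]
        field_simp
    _ ≤ √2 * (√z / z) * (z ^ (2 * ν + 1) / s) * (Real.Gamma (ν + 1))⁻¹ := by
        gcongr
        rw [inv_le_iff_one_le_mul₀ hd, div_mul_eq_mul_div, one_le_div hspos]
        exact hdz
    _ = √2 / s * (Real.Gamma (ν + 1))⁻¹ * z ^ (2 * ν + 1/2) := by
        rw [← hpow]
        ring
    _ ≤ √2 / s * (Real.Gamma (ν + 1))⁻¹ * (A * Real.exp (1/4 * z)) := by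
        gcongr
        exact hAexp z (hmono.monotone n.zero_le)
    _ = _ := by
        rw [show 1/4 * z = z / 4 by ring]
        ring

theorem exists_norm_pKer_le {ν : ℝ} (hν : -(1/2 : ℝ) < ν) {Λ : ℕ → ℝ}
    (hΛ : IsPositiveZerosOfBesselJ ν Λ) :
    ∃ C : ℝ, 0 < C ∧ ∀ t, 1 < t → ∀ x ∈ Ioo (0 : ℝ) 1, ∀ y ∈ Ioo (0 : ℝ) 1,
      ‖pKer ν Λ t x y‖ ≤ C := by
  obtain ⟨B, hB, hφ⟩ := exists_abs_phiFB_le hν hΛ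
  have hsum := (summable_exp_neg_half_zeros hν hΛ).mul_left (B ^ 2)
  refine ⟨∑' n, B ^ 2 * Real.exp (-(Λ n / 2)),
    hsum.tsum_pos (fun n => by positivity) 0 (by positivity), fun t ht x hx y hy => ?_⟩
  refine tsum_of_norm_bounded hsum.hasSum fun n => ?_
  have hz := hΛ.2.1 n
  have hexp : Real.exp (-t * Λ n) ≤ Real.exp (-Λ n) := Real.exp_le_exp.2 (by nlinarith)
  calc ‖Real.exp (-t * Λ n) * phiFB ν Λ n x * phiFB ν Λ n y‖
      = Real.exp (-t * Λ n) * |phiFB ν Λ n x| * |phiFB ν Λ n y| := by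
        rw [norm_mul, norm_mul, Real.norm_eq_abs, Real.abs_exp, Real.norm_eq_abs, Real.norm_eq_abs]
    _ ≤ Real.exp (-Λ n) * (B * Real.exp (Λ n / 4)) * (B * Real.exp (Λ n / 4)) := by
        gcongr
        · exact hφ n x hx
        · exact hφ n y hy
    _ = B ^ 2 * Real.exp (-(Λ n / 2)) := by
        rw [show -(Λ n / 2) = -Λ n + Λ n / 4 + Λ n / 4 by ring, Real.exp_add, Real.exp_add]
        ring

theorem ae_mem_Ioo_muMeas (ν : ℝ) : ∀ᵐ x ∂(muMeas ν), x ∈ Ioo (0 : ℝ) 1 :=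
  (withDensity_absolutelyContinuous _ _).ae_le (ae_restrict_mem measurableSet_Ioo)

theorem muMeas_univ_le_one {ν : ℝ} (hν : -(1/2 : ℝ) < ν) : muMeas ν univ ≤ 1 := by
  rw [muMeas, withDensity_apply _ MeasurableSet.univ, Measure.restrict_univ]
  calc ∫⁻ x in Ioo (0 : ℝ) 1, ENNReal.ofReal (x ^ (2 * ν + 1))
      ≤ ∫⁻ _ in Ioo (0 : ℝ) 1, 1 := by
        refine setLIntegral_mono measurable_const fun x hx => ?_
        rw [ENNReal.ofReal_le_one]
        exact Real.rpow_le_one hx.1.le hx.2.le (by linarith)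
    _ = 1 := by simp

/-- The maximal operator `𝓜^∞ f = sup_{t>1} |𝒫_t f|` is bounded on `L¹((0,1),μ)` (Lemma 4.1). -/
theorem maximal_large_time_L1_bounded_mu (ν : ℝ) (hν : -(1/2 : ℝ) < ν)
    (Λ : ℕ → ℝ) (hΛ : IsPositiveZerosOfBesselJ ν Λ) :
    ∃ C : ℝ, 0 < C ∧
      ∀ f : ℝ → ℝ, Integrable f (muMeas ν) →
        ∫⁻ x, (⨆ t : {t : ℝ // 1 < t},
            (‖∫ y, pKer ν Λ t.1 x y * f y ∂(muMeas ν)‖₊ : ℝ≥0∞)) ∂(muMeas ν)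
          ≤ ENNReal.ofReal C * ∫⁻ y, ‖f y‖₊ ∂(muMeas ν) := by
  obtain ⟨C, hC, hker⟩ := exists_norm_pKer_le hν hΛ
  refine ⟨C, hC, fun f _ => ?_⟩
  have hmain (x : ℝ) (hx : x ∈ Ioo (0 : ℝ) 1) :
      (⨆ t : {t : ℝ // 1 < t}, (‖∫ y, pKer ν Λ t.1 x y * f y ∂(muMeas ν)‖₊ : ℝ≥0∞)) ≤
        ENNReal.ofReal C * ∫⁻ y, ‖f y‖₊ ∂(muMeas ν) := by
    refine iSup_le fun t => ?_
    rw [← lintegral_const_mul' _ _ ENNReal.ofReal_ne_top]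
    refine (enorm_integral_le_lintegral_enorm _).trans (lintegral_mono_ae ?_)
    filter_upwards [ae_mem_Ioo_muMeas ν] with y hy
    rw [enorm_mul]
    refine mul_le_mul_left ?_ _
    rw [← ofReal_norm]
    exact ENNReal.ofReal_le_ofReal (hker t.1 t.2 x hx y hy)
  calc _ ≤ ∫⁻ _, (ENNReal.ofReal C * ∫⁻ y, ‖f y‖₊ ∂(muMeas ν)) ∂(muMeas ν) :=
        lintegral_mono_ae ((ae_mem_Ioo_muMeas ν).mono hmain)
    _ = (ENNReal.ofReal C * ∫⁻ y, ‖f y‖₊ ∂(muMeas ν)) * muMeas ν univ := lintegral_const _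
    _ ≤ _ := mul_le_of_le_one_right' (muMeas_univ_le_one hν)
end
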